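/- arXiv:2404.12951 — 2 statements merged into one kernel-verified Lean document; each statement's English description precedes it below -/
import Mathlib

section
/- (CBV confluence, projected from λ!.) (Surface) The CBV surface reduction →ᵛS is confluent; moreover, any two surface reduction sequences from a common CBV term to a →ᵛS-normal form have the same length and contain the same number of dB-steps and of sV-steps. (Full) The CBV full reduction →ᵛF is confluent. -/
namespace BangPaper

/-! ### Generic rewriting notions -/

/-- `a` is a normal form for the relation `r`. -/
def IsNF {α : Type*} (r : α → α → Prop) (a : α) : Prop := ∀ b, ¬ r a b

/-- Reflexive-transitive closure of the union of two relations,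
counting the number of steps of each. -/
inductive Counted2 {α : Type*} (r₁ r₂ : α → α → Prop) : ℕ → ℕ → α → α → Prop
  | refl (t : α) : Counted2 r₁ r₂ 0 0 t t
  | step₁ {t u v : α} {m n : ℕ} :
      r₁ t u → Counted2 r₁ r₂ m n u v → Counted2 r₁ r₂ (m + 1) n t v
  | step₂ {t u v : α} {m n : ℕ} :
      r₂ t u → Counted2 r₁ r₂ m n u v → Counted2 r₁ r₂ m (n + 1) t v

/-- Reflexive-transitive closure of the union of three relations,
counting the number of steps of each. -/
inductive Counted3 {α : Type*} (r₁ r₂ r₃ : α → α → Prop) : ℕ → ℕ → ℕ → α → α → Prop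
  | refl (t : α) : Counted3 r₁ r₂ r₃ 0 0 0 t t
  | step₁ {t u v : α} {m n k : ℕ} :
      r₁ t u → Counted3 r₁ r₂ r₃ m n k u v → Counted3 r₁ r₂ r₃ (m + 1) n k t v
  | step₂ {t u v : α} {m n k : ℕ} :
      r₂ t u → Counted3 r₁ r₂ r₃ m n k u v → Counted3 r₁ r₂ r₃ m (n + 1) k t v
  | step₃ {t u v : α} {m n k : ℕ} :
      r₃ t u → Counted3 r₁ r₂ r₃ m n k u v → Counted3 r₁ r₂ r₃ m n (k + 1) t v

/-! ### Terms of the distant Bang calculus λ! (de Bruijn representation) -/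

/-- Terms of λ!: variables, application, abstraction, bang, dereliction and
explicit substitution (`sub t u` is `t[x←u]`, the binder being in `t`). -/
inductive T : Type
  | var : ℕ → T
  | app : T → T → T
  | lam : T → T
  | bang : T → T
  | der : T → T
  | sub : T → T → T

namespace T

/-- Lift (shift by one) the free de Bruijn variables `≥ k`. -/
def lift (k : ℕ) : T → T
  | var n => if n < k then var n else var (n + 1)
  | app a b => app (lift k a) (lift k b)
  | lam a => lam (lift (k + 1) a)
  | bang a => bang (lift k a)
  | der a => der (lift k a)
  | sub a b => sub (lift (k + 1) a) (lift k b)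

/-- Lift all free variables by `m` (crossing `m` binders). -/
def liftN (m : ℕ) (t : T) : T := (lift 0)^[m] t

/-- Lift all free variables except the first one by `m`
(used to push a term with one distinguished bound variable under `m` extra binders). -/
def liftUnder (m : ℕ) (t : T) : T := (lift 1)^[m] t

/-- Capture-avoiding substitution `t{k := u}` of `u` for de Bruijn variable `k`. -/
def subst : T → ℕ → T → T
  | var n, k, u => if n < k then var n else if n = k then liftN k u else var (n - 1)
  | app a b, k, u => app (subst a k u) (subst b k u)
  | lam a, k, u => lam (subst a (k + 1) u)
  | bang a, k, u => bang (subst a k u)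
  | der a, k, u => der (subst a k u)
  | sub a b, k, u => sub (subst a (k + 1) u) (subst b k u)

/-- The number of constructors (full size) of a term: it counts all
applications, abstractions, explicit substitutions, `!` and `der` occurrences. -/
def size : T → ℕ
  | var _ => 0
  | app a b => 1 + size a + size b
  | lam a => 1 + size a
  | bang a => 1 + size a
  | der a => 1 + size a
  | sub a b => 1 + size a + size b

end T

/-- Plugging a term into a list context `⟨·⟩[x₁←t₁]…[xₙ←tₙ]`
(represented as the list `[t₁, …, tₙ]`). -/
def fillL : T → List T → T
  | s, [] => s
  | s, t :: L => fillL (T.sub s t) L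

/-! ### Rewrite rules of λ! -/

/-- The names of the three rewrite rules of λ!: `dB`, `s!` and `d!`. -/
inductive Rule : Type
  | dB : Rule
  | sBang : Rule
  | dBang : Rule

/-- Root steps of the three rewrite rules of λ! (at a distance, capture-free):
`(dB)  L⟨λx.t⟩ u ↦ L⟨t[x←u]⟩`, `(s!)  t[x←L⟨!u⟩] ↦ L⟨t{x:=u}⟩`,
`(d!)  der(L⟨!t⟩) ↦ L⟨t⟩`. -/
inductive Root : Rule → T → T → Prop
  | dB (t u : T) (L : List T) :
      Root Rule.dB (T.app (fillL (T.lam t) L) u)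
        (fillL (T.sub t (T.liftN L.length u)) L)
  | sBang (t u : T) (L : List T) :
      Root Rule.sBang (T.sub t (fillL (T.bang u) L))
        (fillL (T.subst (T.liftUnder L.length t) 0 u) L)
  | dBang (t : T) (L : List T) :
      Root Rule.dBang (T.der (fillL (T.bang t) L)) (fillL t L)

/-! ### Contexts of λ! -/

/-- (Full) contexts of λ!: terms with exactly one hole, the hole may occur anywhere. -/
inductive Ctx : Type
  | hole : Ctx
  | appL : Ctx → T → Ctx
  | appR : T → Ctx → Ctx
  | lam : Ctx → Ctx
  | bang : Ctx → Ctx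
  | der : Ctx → Ctx
  | subL : Ctx → T → Ctx
  | subR : T → Ctx → Ctx

namespace Ctx

/-- Plugging a term in a context (possibly capturing its free variables). -/
def fill : Ctx → T → T
  | hole, s => s
  | appL C t, s => T.app (fill C s) t
  | appR t C, s => T.app t (fill C s)
  | lam C, s => T.lam (fill C s)
  | bang C, s => T.bang (fill C s)
  | der C, s => T.der (fill C s)
  | subL C t, s => T.sub (fill C s) t
  | subR t C, s => T.sub t (fill C s)

/-- Surface contexts: the hole does not occur under a `!`. -/
def Surface : Ctx → Prop
  | hole => True
  | appL C _ => Surface C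
  | appR _ C => Surface C
  | lam C => Surface C
  | bang _ => False
  | der C => Surface C
  | subL C _ => Surface C
  | subR _ C => Surface C

/-- Internal contexts: the full contexts that are not surface (the hole occurs under a `!`). -/
def Internal (C : Ctx) : Prop := ¬ Surface C

end Ctx

/-! ### Reductions of λ! -/

/-- `StepAt R C t u`: `t` rewrites to `u` by firing a redex of rule `R` under context `C`. -/
def StepAt (R : Rule) (C : Ctx) (t u : T) : Prop :=
  ∃ a b, Root R a b ∧ t = C.fill a ∧ u = C.fill b

/-- One step of rule `R` under some full context (`→F,R`). -/
def FStepR (R : Rule) (t u : T) : Prop := ∃ C : Ctx, StepAt R C t u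

/-- One step of rule `R` under some surface context (`→S,R`). -/
def SStepR (R : Rule) (t u : T) : Prop := ∃ C : Ctx, C.Surface ∧ StepAt R C t u

/-- One step of rule `R` under some internal context (`→I,R`). -/
def IStepR (R : Rule) (t u : T) : Prop := ∃ C : Ctx, C.Internal ∧ StepAt R C t u

/-- Full reduction `→F` of λ!. -/
def FStep (t u : T) : Prop := ∃ R, FStepR R t u

/-- Surface reduction `→S` of λ!. -/
def SStep (t u : T) : Prop := ∃ R, SStepR R t u

/-- Internal reduction `→I` of λ!. -/
def IStep (t u : T) : Prop := ∃ R, IStepR R t u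

/-- Diligent administrative surface reduction `→Sai`: `d!`-surface steps, together with
`dB`- and `s!`-surface steps whose source is a `→S,d!`-normal form. -/
def SaiStep (t u : T) : Prop :=
  SStepR Rule.dBang t u ∨
    ((SStepR Rule.dB t u ∨ SStepR Rule.sBang t u) ∧ IsNF (SStepR Rule.dBang) t)

/-- Diligent administrative full reduction `→Fai`: `d!`-full steps, together with
`dB`- and `s!`-full steps whose source is a `→F,d!`-normal form. -/
def FaiStep (t u : T) : Prop :=
  FStepR Rule.dBang t u ∨
    ((FStepR Rule.dB t u ∨ FStepR Rule.sBang t u) ∧ IsNF (FStepR Rule.dBang) t)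

/-! ### Terms of the CBN / CBV calculi (shared syntax, de Bruijn) -/

/-- Terms of the CBN/CBV calculi: variables, application, abstraction and
explicit substitution (no `!`, no `der`). -/
inductive LT : Type
  | var : ℕ → LT
  | app : LT → LT → LT
  | lam : LT → LT
  | sub : LT → LT → LT

namespace LT

/-- Lift (shift by one) the free de Bruijn variables `≥ k`. -/
def lift (k : ℕ) : LT → LT
  | var n => if n < k then var n else var (n + 1)
  | app a b => app (lift k a) (lift k b)
  | lam a => lam (lift (k + 1) a)
  | sub a b => sub (lift (k + 1) a) (lift k b)

/-- Lift all free variables by `m`. -/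
def liftN (m : ℕ) (t : LT) : LT := (lift 0)^[m] t

/-- Lift all free variables except the first one by `m`. -/
def liftUnder (m : ℕ) (t : LT) : LT := (lift 1)^[m] t

/-- Capture-avoiding substitution `t{k := u}`. -/
def subst : LT → ℕ → LT → LT
  | var n, k, u => if n < k then var n else if n = k then liftN k u else var (n - 1)
  | app a b, k, u => app (subst a k u) (subst b k u)
  | lam a, k, u => lam (subst a (k + 1) u)
  | sub a b, k, u => sub (subst a (k + 1) u) (subst b k u)

/-- Values: variables and abstractions. -/
def IsValue : LT → Prop
  | var _ => True
  | lam _ => True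
  | _ => False

end LT

/-- Plugging a CBN/CBV term into a list context. -/
def fillLN : LT → List LT → LT
  | s, [] => s
  | s, t :: L => fillLN (LT.sub s t) L

/-- The names of the CBN rewrite rules: `dB` and `s`. -/
inductive NRule : Type
  | dB : NRule
  | s : NRule

/-- Root steps of the CBN rules:
`(dB) L⟨λx.t⟩ u ↦ L⟨t[x←u]⟩` and `(s) t[x←u] ↦ t{x:=u}`. -/
inductive NRoot : NRule → LT → LT → Prop
  | dB (t u : LT) (L : List LT) :
      NRoot NRule.dB (LT.app (fillLN (LT.lam t) L) u)
        (fillLN (LT.sub t (LT.liftN L.length u)) L)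
  | s (t u : LT) : NRoot NRule.s (LT.sub t u) (LT.subst t 0 u)

/-- The names of the CBV rewrite rules: `dB` and `sV`. -/
inductive VRule : Type
  | dB : VRule
  | sV : VRule

/-- Root steps of the CBV rules:
`(dB) L⟨λx.t⟩ u ↦ L⟨t[x←u]⟩` and `(sV) t[x←L⟨v⟩] ↦ L⟨t{x:=v}⟩` for `v` a value. -/
inductive VRoot : VRule → LT → LT → Prop
  | dB (t u : LT) (L : List LT) :
      VRoot VRule.dB (LT.app (fillLN (LT.lam t) L) u)
        (fillLN (LT.sub t (LT.liftN L.length u)) L)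
  | sV (t v : LT) (L : List LT) : v.IsValue →
      VRoot VRule.sV (LT.sub t (fillLN v L))
        (fillLN (LT.subst (LT.liftUnder L.length t) 0 v) L)

/-- (Full) contexts of the CBN/CBV calculi. -/
inductive LCtx : Type
  | hole : LCtx
  | appL : LCtx → LT → LCtx
  | appR : LT → LCtx → LCtx
  | lam : LCtx → LCtx
  | subL : LCtx → LT → LCtx
  | subR : LT → LCtx → LCtx

namespace LCtx

/-- Plugging a term in a CBN/CBV context. -/
def fill : LCtx → LT → LT
  | hole, s => s
  | appL C t, s => LT.app (fill C s) t
  | appR t C, s => LT.app t (fill C s)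
  | lam C, s => LT.lam (fill C s)
  | subL C t, s => LT.sub (fill C s) t
  | subR t C, s => LT.sub t (fill C s)

/-- CBN surface contexts: the hole never occurs in the argument of an application
or of an explicit substitution. -/
def NSurface : LCtx → Prop
  | hole => True
  | appL C _ => NSurface C
  | appR _ _ => False
  | lam C => NSurface C
  | subL C _ => NSurface C
  | subR _ _ => False

/-- CBV surface contexts: the hole never occurs under an abstraction. -/
def VSurface : LCtx → Prop
  | hole => True
  | appL C _ => VSurface C
  | appR _ C => VSurface C
  | lam _ => False
  | subL C _ => VSurface C
  | subR _ C => VSurface C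

end LCtx

/-- `NStepAt R C t u`: the CBN step firing rule `R` under context `C`. -/
def NStepAt (R : NRule) (C : LCtx) (t u : LT) : Prop :=
  ∃ a b, NRoot R a b ∧ t = C.fill a ∧ u = C.fill b

/-- `VStepAt R C t u`: the CBV step firing rule `R` under context `C`. -/
def VStepAt (R : VRule) (C : LCtx) (t u : LT) : Prop :=
  ∃ a b, VRoot R a b ∧ t = C.fill a ∧ u = C.fill b

/-- One CBN step of rule `R` under some full context. -/
def NFStepR (R : NRule) (t u : LT) : Prop := ∃ C : LCtx, NStepAt R C t u

/-- One CBN step of rule `R` under some surface context. -/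
def NSStepR (R : NRule) (t u : LT) : Prop := ∃ C : LCtx, C.NSurface ∧ NStepAt R C t u

/-- One CBN step of rule `R` under some internal context. -/
def NIStepR (R : NRule) (t u : LT) : Prop := ∃ C : LCtx, ¬ C.NSurface ∧ NStepAt R C t u

/-- CBN full reduction `→ⁿF`. -/
def NFStep (t u : LT) : Prop := ∃ R, NFStepR R t u

/-- CBN surface reduction `→ⁿS`. -/
def NSStep (t u : LT) : Prop := ∃ R, NSStepR R t u

/-- CBN internal reduction `→ⁿI`. -/
def NIStep (t u : LT) : Prop := ∃ R, NIStepR R t u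

/-- One CBV step of rule `R` under some full context. -/
def VFStepR (R : VRule) (t u : LT) : Prop := ∃ C : LCtx, VStepAt R C t u

/-- One CBV step of rule `R` under some surface context. -/
def VSStepR (R : VRule) (t u : LT) : Prop := ∃ C : LCtx, C.VSurface ∧ VStepAt R C t u

/-- One CBV step of rule `R` under some internal context. -/
def VIStepR (R : VRule) (t u : LT) : Prop := ∃ C : LCtx, ¬ C.VSurface ∧ VStepAt R C t u

/-- CBV full reduction `→ᵛF`. -/
def VFStep (t u : LT) : Prop := ∃ R, VFStepR R t u

/-- CBV surface reduction `→ᵛS`. -/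
def VSStep (t u : LT) : Prop := ∃ R, VSStepR R t u

/-- CBV internal reduction `→ᵛI`. -/
def VIStep (t u : LT) : Prop := ∃ R, VIStepR R t u

/-! ### The CBN embedding into λ! -/

/-- The CBN embedding `(·)ⁿ : xⁿ = x, (λx.t)ⁿ = λx.tⁿ, (t u)ⁿ = tⁿ !(uⁿ),
(t[x←u])ⁿ = tⁿ[x←!(uⁿ)]`. -/
def embN : LT → T
  | LT.var n => T.var n
  | LT.app t u => T.app (embN t) (T.bang (embN u))
  | LT.lam t => T.lam (embN t)
  | LT.sub t u => T.sub (embN t) (T.bang (embN u))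

/-- The CBN embedding extended to contexts, with `⟨·⟩ⁿ = ⟨·⟩`. -/
def embNC : LCtx → Ctx
  | LCtx.hole => Ctx.hole
  | LCtx.appL C t => Ctx.appL (embNC C) (T.bang (embN t))
  | LCtx.appR t C => Ctx.appR (embN t) (Ctx.bang (embNC C))
  | LCtx.lam C => Ctx.lam (embNC C)
  | LCtx.subL C t => Ctx.subL (embNC C) (T.bang (embN t))
  | LCtx.subR t C => Ctx.subR (embN t) (Ctx.bang (embNC C))

/-- The CBN embedding on rule names: `dBⁿ = dB`, `sⁿ = s!`. -/
def embNRule : NRule → Rule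
  | NRule.dB => Rule.dB
  | NRule.s => Rule.sBang

/-! ### The CBV embedding into λ! -/

/-- If `t = L⟨!s⟩` for a list context `L`, return `some L⟨s⟩`, otherwise `none`. -/
def strip? : T → Option T
  | T.bang s => some s
  | T.sub a b => (strip? a).map (fun a' => T.sub a' b)
  | _ => none

/-- The (new) CBV embedding `(·)ᵛ : xᵛ = !x, (λx.t)ᵛ = !λx.!(tᵛ),
(t u)ᵛ = der(L⟨s⟩ uᵛ)` if `tᵛ = L⟨!s⟩` and `der(der(tᵛ) uᵛ)` otherwise,
`(t[x←u])ᵛ = tᵛ[x←uᵛ]`. -/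
def embV : LT → T
  | LT.var n => T.bang (T.var n)
  | LT.lam t => T.bang (T.lam (T.bang (embV t)))
  | LT.app t u =>
      match strip? (embV t) with
      | some s => T.der (T.app s (embV u))
      | none => T.der (T.app (T.der (embV t)) (embV u))
  | LT.sub t u => T.sub (embV t) (embV u)

/-- The CBV embedding on rule names: `dBᵛ = dB`, `sVᵛ = s!`. -/
def embVRule : VRule → Rule
  | VRule.dB => Rule.dB
  | VRule.sV => Rule.sBang

namespace LT

/-! ### Lifting and substitution -/

theorem lift_lift (t : LT) {i j : ℕ} (h : i ≤ j) :
    lift i (lift j t) = lift (j + 1) (lift i t) := by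
  induction t generalizing i j with
  | var n => simp only [lift]; split_ifs <;> simp only [lift] <;> split_ifs <;> first | rfl | omega
  | app a b iha ihb => simp only [lift, iha h, ihb h]
  | lam a ih => simp only [lift, ih (Nat.succ_le_succ h)]
  | sub a b iha ihb => simp only [lift, iha (Nat.succ_le_succ h), ihb h]

theorem liftN_succ (k : ℕ) (u : LT) : liftN (k + 1) u = lift 0 (liftN k u) :=
  Function.iterate_succ_apply' _ _ _

theorem lift_liftN_of_le (u : LT) {i k : ℕ} (h : i ≤ k) :
    lift i (liftN k u) = liftN (k + 1) u := by
  induction k generalizing i with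
  | zero => obtain rfl : i = 0 := by omega
            rfl
  | succ k ih =>
    cases i with
    | zero => rw [← liftN_succ]
    | succ i => rw [liftN_succ, ← lift_lift _ (Nat.zero_le i), ih (by omega), ← liftN_succ]

theorem lift_add_liftN (u : LT) (j k : ℕ) :
    lift (k + j) (liftN k u) = liftN k (lift j u) := by
  induction k with
  | zero => simp [liftN]
  | succ k ih =>
    rw [liftN_succ, liftN_succ, ← ih, lift_lift _ (Nat.zero_le _), Nat.add_right_comm]

theorem subst_lift (t u : LT) (k : ℕ) : subst (lift k t) k u = t := by
  induction t generalizing k with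
  | var n =>
    simp only [lift]
    split_ifs with h
    · simp [subst, h]
    · simp only [subst]
      rw [if_neg (by omega), if_neg (by omega)]
      rfl
  | app a b iha ihb => simp only [lift, subst, iha, ihb]
  | lam a ih => simp only [lift, subst, ih]
  | sub a b iha ihb => simp only [lift, subst, iha, ihb]

theorem lift_subst_of_le (t u : LT) {i k : ℕ} (h : i ≤ k) :
    lift i (subst t k u) = subst (lift i t) (k + 1) u := by
  induction t generalizing i k with
  | var n =>
    rcases lt_trichotomy n k with hn | rfl | hn
    · simp only [subst, lift, if_pos hn]
      split_ifs <;> simp only [subst] <;> rw [if_pos (by omega)]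
    · simp only [subst, lift, if_neg (lt_irrefl n), if_neg (not_lt.2 h), if_true]
      simp [lift_liftN_of_le u h]
    · obtain ⟨n, rfl⟩ : ∃ p, n = p + 1 := ⟨n - 1, by omega⟩
      simp only [subst, lift]
      rw [if_neg (by omega), if_neg (by omega), if_neg (by omega : ¬ n + 1 < i)]
      simp only [subst, lift, Nat.add_sub_cancel]
      rw [if_neg (by omega), if_neg (by omega), if_neg (by omega)]
  | app a b iha ihb => simp only [lift, subst, iha h, ihb h]
  | lam a ih => simp only [lift, subst, ih (Nat.succ_le_succ h)]
  | sub a b iha ihb => simp only [lift, subst, iha (Nat.succ_le_succ h), ihb h]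

theorem lift_add_subst (t u : LT) (j k : ℕ) :
    lift (k + j) (subst t k u) = subst (lift (k + j + 1) t) k (lift j u) := by
  induction t generalizing k with
  | var n =>
    rcases lt_trichotomy n k with hn | rfl | hn
    · simp only [subst, lift, if_pos hn]
      rw [if_pos (by omega), if_pos (by omega)]
      simp only [subst, if_pos hn]
    · simp only [subst, lift, if_neg (lt_irrefl n), if_true]
      rw [if_pos (by omega), lift_add_liftN]
      simp [subst]
    · obtain ⟨n, rfl⟩ : ∃ p, n = p + 1 := ⟨n - 1, by omega⟩
      simp only [subst, lift]
      rw [if_neg (by omega), if_neg (by omega)]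
      simp only [lift, Nat.add_sub_cancel, Nat.add_lt_add_iff_right]
      split_ifs <;> simp only [subst] <;> rw [if_neg (by omega), if_neg (by omega)] <;> rfl
  | app a b iha ihb => simp only [lift, subst, iha, ihb]
  | lam a ih =>
    have h := ih (k + 1)
    rw [Nat.add_right_comm k 1 j] at h
    simp only [lift, subst, h]
  | sub a b iha ihb =>
    have h := iha (k + 1)
    rw [Nat.add_right_comm k 1 j] at h
    simp only [lift, subst, h, ihb]

theorem subst_add_liftN (v w : LT) (j k : ℕ) :
    subst (liftN k v) (k + j) w = liftN k (subst v j w) := by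
  induction k with
  | zero => simp [liftN]
  | succ k ih =>
    rw [liftN_succ, liftN_succ, ← ih, lift_subst_of_le _ _ (Nat.zero_le _), Nat.add_right_comm]

theorem subst_liftN_add (w v : LT) (j k : ℕ) :
    subst (liftN (k + j + 1) w) k v = liftN (k + j) w := by
  rw [← lift_liftN_of_le w (Nat.le_add_right k j), subst_lift]

theorem subst_subst (t v w : LT) (j k : ℕ) :
    subst (subst t k v) (k + j) w = subst (subst t (k + j + 1) w) k (subst v j w) := by
  induction t generalizing k with
  | var n =>
    rcases lt_trichotomy n k with hn | rfl | hn
    · simp only [subst, if_pos hn]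
      rw [if_pos (by omega : n < k + j + 1)]
      simp only [subst]
      rw [if_pos (by omega), if_pos hn]
    · simp only [subst, if_neg (lt_irrefl n), if_true]
      rw [if_pos (by omega), subst_add_liftN]
      simp [subst]
    · obtain ⟨n, rfl⟩ : ∃ p, n = p + 1 := ⟨n - 1, by omega⟩
      simp only [subst]
      rw [if_neg (by omega : ¬ n + 1 < k), if_neg (by omega : ¬ n + 1 = k)]
      simp only [subst, Nat.add_sub_cancel, Nat.add_lt_add_iff_right, Nat.add_right_cancel_iff]
      split_ifs with h₁ h₂
      · simp only [subst]
        rw [if_neg (by omega), if_neg (by omega)]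
        rfl
      · rw [subst_liftN_add]
      · simp only [subst]
        rw [if_neg (by omega), if_neg (by omega)]
  | app a b iha ihb => simp only [subst, iha, ihb]
  | lam a ih =>
    have h := ih (k + 1)
    rw [Nat.add_right_comm k 1 j] at h
    simp only [subst, h]
  | sub a b iha ihb =>
    have h := iha (k + 1)
    rw [Nat.add_right_comm k 1 j] at h
    simp only [subst, h, ihb]

theorem IsValue.lift {v : LT} (h : v.IsValue) (k : ℕ) : (lift k v).IsValue := by
  cases v with
  | var n => simp only [LT.lift]; split_ifs <;> trivial
  | lam a => trivial
  | app a b => exact h.elim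
  | sub a b => exact h.elim

theorem IsValue.liftN {v : LT} (h : v.IsValue) (k : ℕ) : (liftN k v).IsValue := by
  induction k with
  | zero => exact h
  | succ k ih => rw [liftN_succ]; exact ih.lift 0

theorem IsValue.subst {v w : LT} (h : v.IsValue) (hw : w.IsValue) (k : ℕ) :
    (subst v k w).IsValue := by
  cases v with
  | var n =>
    simp only [LT.subst]
    split_ifs
    · trivial
    · exact hw.liftN k
    · trivial
  | lam a => trivial
  | app a b => exact h.elim
  | sub a b => exact h.elim

end LT

open BangPaper.LT

/-! ### Root steps at a distance, without list contexts -/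

/-- `DistBeta a u r`: `a` has the form `L⟨λx.t⟩` and `r` is `L⟨t[x←u]⟩`. -/
inductive DistBeta : LT → LT → LT → Prop
  | lam (t u : LT) : DistBeta (LT.lam t) u (LT.sub t u)
  | sub {a u r : LT} (s : LT) :
      DistBeta a (lift 0 u) r → DistBeta (LT.sub a s) u (LT.sub r s)

/-- `DistSubst t s r`: `s` has the form `L⟨v⟩` with `v` a value and `r` is `L⟨t{x:=v}⟩`. -/
inductive DistSubst : LT → LT → LT → Prop
  | val (t : LT) {v : LT} : v.IsValue → DistSubst t v (subst t 0 v)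
  | sub {t a r : LT} (s : LT) :
      DistSubst (lift 1 t) a r → DistSubst t (LT.sub a s) (LT.sub r s)

theorem fillLN_append (s t : LT) (L : List LT) :
    fillLN s (L ++ [t]) = LT.sub (fillLN s L) t := by
  induction L generalizing s with
  | nil => rfl
  | cons a L ih => exact ih _

theorem distBeta_fillLN (t u : LT) (L : List LT) :
    DistBeta (fillLN (LT.lam t) L) u (fillLN (LT.sub t (liftN L.length u)) L) := by
  induction L using List.reverseRecOn generalizing u with
  | nil => exact .lam t u
  | append_singleton L s ih =>
    rw [fillLN_append, fillLN_append, List.length_append]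
    exact .sub s (ih (lift 0 u))

theorem distSubst_fillLN (t : LT) {v : LT} (L : List LT) (hv : v.IsValue) :
    DistSubst t (fillLN v L) (fillLN (subst (liftUnder L.length t) 0 v) L) := by
  induction L using List.reverseRecOn generalizing t with
  | nil => exact .val t hv
  | append_singleton L s ih =>
    rw [fillLN_append, fillLN_append, List.length_append]
    exact .sub s (ih (lift 1 t))

theorem DistBeta.vRoot {a u r : LT} (h : DistBeta a u r) : VRoot .dB (LT.app a u) r := by
  have : ∃ t L, a = fillLN (LT.lam t) L ∧ r = fillLN (LT.sub t (liftN L.length u)) L := by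
    induction h with
    | lam t u => exact ⟨t, [], rfl, rfl⟩
    | sub s _ ih =>
      obtain ⟨t, L, rfl, rfl⟩ := ih
      refine ⟨t, L ++ [s], (fillLN_append ..).symm, ?_⟩
      rw [fillLN_append, List.length_append]
      rfl
  obtain ⟨t, L, rfl, rfl⟩ := this
  exact .dB t u L

theorem DistSubst.vRoot {t s r : LT} (h : DistSubst t s r) : VRoot .sV (LT.sub t s) r := by
  have : ∃ v L, v.IsValue ∧ s = fillLN v L ∧
      r = fillLN (subst (liftUnder L.length t) 0 v) L := by
    induction h with
    | @val t v hv => exact ⟨v, [], hv, rfl, rfl⟩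
    | sub s _ ih =>
      obtain ⟨v, L, hv, rfl, rfl⟩ := ih
      refine ⟨v, L ++ [s], hv, (fillLN_append ..).symm, ?_⟩
      rw [fillLN_append, List.length_append]
      rfl
  obtain ⟨v, L, hv, rfl, rfl⟩ := this
  exact .sV t v L hv

namespace DistBeta

theorem unique {a u r₁ r₂ : LT} (h₁ : DistBeta a u r₁) (h₂ : DistBeta a u r₂) : r₁ = r₂ := by
  induction h₁ generalizing r₂ with
  | lam t u => cases h₂; rfl
  | sub s _ ih => cases h₂ with | sub _ h => rw [ih h]

protected theorem lift {a u r : LT} (h : DistBeta a u r) (k : ℕ) :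
    DistBeta (lift k a) (lift k u) (lift k r) := by
  induction h generalizing k with
  | lam t u => exact .lam _ _
  | sub s _ ih =>
    refine .sub _ ?_
    rw [lift_lift _ (Nat.zero_le k)]
    exact ih (k + 1)

protected theorem subst {a u r : LT} (h : DistBeta a u r) (k : ℕ) (v : LT) :
    DistBeta (subst a k v) (subst u k v) (subst r k v) := by
  induction h generalizing k with
  | lam t u => exact .lam _ _
  | sub s _ ih =>
    refine .sub _ ?_
    rw [lift_subst_of_le _ _ (Nat.zero_le k)]
    exact ih (k + 1)

end DistBeta

namespace DistSubst

theorem unique {t s r₁ r₂ : LT} (h₁ : DistSubst t s r₁) (h₂ : DistSubst t s r₂) : r₁ = r₂ := by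
  induction h₁ generalizing r₂ with
  | val t hv =>
    cases h₂ with
    | val _ _ => rfl
    | sub _ _ => exact hv.elim
  | sub s _ ih =>
    cases h₂ with
    | val _ hv => exact hv.elim
    | sub _ h => rw [ih h]

protected theorem lift {t s r : LT} (h : DistSubst t s r) (k : ℕ) :
    DistSubst (lift (k + 1) t) (lift k s) (lift k r) := by
  induction h generalizing k with
  | @val t v hv =>
    have h := lift_add_subst t v k 0
    rw [Nat.zero_add] at h
    rw [h]
    exact .val _ (hv.lift k)
  | sub s _ ih =>
    refine .sub _ ?_
    rw [lift_lift _ (Nat.le_add_left 1 k)]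
    exact ih (k + 1)

protected theorem subst {t s r v : LT} (h : DistSubst t s r) (hv : v.IsValue) (k : ℕ) :
    DistSubst (subst t (k + 1) v) (subst s k v) (subst r k v) := by
  induction h generalizing k with
  | @val t w hw =>
    have h := subst_subst t w v k 0
    rw [Nat.zero_add] at h
    rw [h]
    exact .val _ (hw.subst hv k)
  | sub s _ ih =>
    refine .sub _ ?_
    rw [lift_subst_of_le _ _ (Nat.le_add_left 1 k)]
    exact ih (k + 1)

end DistSubst

/-- Firing `dB` commutes with firing an explicit substitution of its list context. -/
theorem DistSubst.distBeta_comm {a s b w r : LT} (hs : DistSubst a s b)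
    (hb : DistBeta a (lift 0 w) r) : ∃ r', DistBeta b w r' ∧ DistSubst r s r' := by
  induction hs generalizing w r with
  | @val a v hv =>
    have h := hb.subst 0 v
    rw [subst_lift] at h
    exact ⟨_, h, .val r hv⟩
  | sub s _ ih =>
    have h := hb.lift 1
    rw [← lift_lift _ (le_refl 0)] at h
    obtain ⟨r', h₁, h₂⟩ := ih h
    exact ⟨_, .sub s h₁, .sub s h₂⟩

/-- Firing `sV` commutes with firing an explicit substitution of its list context. -/
theorem DistSubst.distSubst_comm {a s b t r : LT} (hs : DistSubst a s b)
    (hr : DistSubst (lift 1 t) a r) : ∃ r', DistSubst t b r' ∧ DistSubst r s r' := by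
  induction hs generalizing t r with
  | @val a v hv =>
    have h := hr.subst hv 0
    rw [subst_lift] at h
    exact ⟨_, h, .val r hv⟩
  | sub s _ ih =>
    have h := hr.lift 1
    rw [← lift_lift _ (le_refl 1)] at h
    obtain ⟨r', h₁, h₂⟩ := ih h
    exact ⟨_, .sub s h₁, .sub s h₂⟩

/-! ### Surface reduction -/

/-- Inductive presentation of the CBV surface steps of a given rule. -/
inductive SurfStep : VRule → LT → LT → Prop
  | dB {a u r : LT} : DistBeta a u r → SurfStep .dB (LT.app a u) r
  | sV {t s r : LT} : DistSubst t s r → SurfStep .sV (LT.sub t s) r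
  | appL {R : VRule} {a b : LT} (u : LT) : SurfStep R a b → SurfStep R (LT.app a u) (LT.app b u)
  | appR {R : VRule} {a b : LT} (u : LT) : SurfStep R a b → SurfStep R (LT.app u a) (LT.app u b)
  | subL {R : VRule} {a b : LT} (u : LT) : SurfStep R a b → SurfStep R (LT.sub a u) (LT.sub b u)
  | subR {R : VRule} {a b : LT} (u : LT) : SurfStep R a b → SurfStep R (LT.sub u a) (LT.sub u b)

theorem VRoot.surfStep {R : VRule} {a b : LT} (h : VRoot R a b) : SurfStep R a b := by
  cases h with
  | dB t u L => exact .dB (distBeta_fillLN t u L)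
  | sV t v L hv => exact .sV (distSubst_fillLN t L hv)

theorem vSStepR_iff_surfStep {R : VRule} {t u : LT} : VSStepR R t u ↔ SurfStep R t u := by
  constructor
  · rintro ⟨C, hC, a, b, h, rfl, rfl⟩
    induction C with
    | hole => exact h.surfStep
    | appL C s ih => exact .appL s (ih hC)
    | appR s C ih => exact .appR s (ih hC)
    | lam C => exact hC.elim
    | subL C s ih => exact .subL s (ih hC)
    | subR s C ih => exact .subR s (ih hC)
  · intro h
    induction h with
    | dB h => exact ⟨.hole, trivial, _, _, h.vRoot, rfl, rfl⟩
    | sV h => exact ⟨.hole, trivial, _, _, h.vRoot, rfl, rfl⟩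
    | appL s _ ih =>
      obtain ⟨C, hC, a, b, h, rfl, rfl⟩ := ih
      exact ⟨.appL C s, hC, a, b, h, rfl, rfl⟩
    | appR s _ ih =>
      obtain ⟨C, hC, a, b, h, rfl, rfl⟩ := ih
      exact ⟨.appR s C, hC, a, b, h, rfl, rfl⟩
    | subL s _ ih =>
      obtain ⟨C, hC, a, b, h, rfl, rfl⟩ := ih
      exact ⟨.subL C s, hC, a, b, h, rfl, rfl⟩
    | subR s _ ih =>
      obtain ⟨C, hC, a, b, h, rfl, rfl⟩ := ih
      exact ⟨.subR s C, hC, a, b, h, rfl, rfl⟩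

namespace SurfStep

theorem not_isValue {R : VRule} {t u : LT} (h : SurfStep R t u) : ¬ t.IsValue := by
  cases h <;> exact id

protected theorem lift {R : VRule} {t u : LT} (h : SurfStep R t u) (k : ℕ) :
    SurfStep R (lift k t) (lift k u) := by
  induction h generalizing k with
  | dB h => exact .dB (h.lift k)
  | sV h => exact .sV (h.lift k)
  | appL _ _ ih => exact .appL _ (ih k)
  | appR _ _ ih => exact .appR _ (ih k)
  | subL _ _ ih => exact .subL _ (ih (k + 1))
  | subR _ _ ih => exact .subR _ (ih k)

protected theorem subst {R : VRule} {t u v : LT} (h : SurfStep R t u) (hv : v.IsValue) (k : ℕ) :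
    SurfStep R (subst t k v) (subst u k v) := by
  induction h generalizing k with
  | dB h => exact .dB (h.subst k v)
  | sV h => exact .sV (h.subst hv k)
  | appL _ _ ih => exact .appL _ (ih k)
  | appR _ _ ih => exact .appR _ (ih k)
  | subL _ _ ih => exact .subL _ (ih (k + 1))
  | subR _ _ ih => exact .subR _ (ih k)

theorem distBeta_left {R : VRule} {a b u r : LT} (h : SurfStep R a b) (hr : DistBeta a u r) :
    ∃ r', DistBeta b u r' ∧ SurfStep R r r' := by
  induction hr generalizing b with
  | lam t u => cases h
  | sub s hr ih =>
    cases h with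
    | sV hs =>
      obtain ⟨r', h₁, h₂⟩ := hs.distBeta_comm hr
      exact ⟨r', h₁, .sV h₂⟩
    | subL _ h =>
      obtain ⟨r', h₁, h₂⟩ := ih h
      exact ⟨_, .sub s h₁, .subL s h₂⟩
    | subR _ h => exact ⟨_, .sub _ hr, .subR _ h⟩

theorem distBeta_right {R : VRule} {a u w r : LT} (h : SurfStep R u w) (hr : DistBeta a u r) :
    ∃ r', DistBeta a w r' ∧ SurfStep R r r' := by
  induction hr generalizing w with
  | lam t u => exact ⟨_, .lam t w, .subR t h⟩
  | sub s _ ih =>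
    obtain ⟨r', h₁, h₂⟩ := ih (h.lift 0)
    exact ⟨_, .sub s h₁, .subL s h₂⟩

theorem distSubst_left {R : VRule} {t t' s r : LT} (h : SurfStep R t t') (hr : DistSubst t s r) :
    ∃ r', DistSubst t' s r' ∧ SurfStep R r r' := by
  induction hr generalizing t' with
  | val t hv => exact ⟨_, .val t' hv, h.subst hv 0⟩
  | sub s _ ih =>
    obtain ⟨r', h₁, h₂⟩ := ih (h.lift 1)
    exact ⟨_, .sub s h₁, .subL s h₂⟩

theorem distSubst_right {R : VRule} {t s s' r : LT} (h : SurfStep R s s') (hr : DistSubst t s r) :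
    ∃ r', DistSubst t s' r' ∧ SurfStep R r r' := by
  induction hr generalizing s' with
  | val t hv => exact (h.not_isValue hv).elim
  | sub s hr ih =>
    cases h with
    | sV hs =>
      obtain ⟨r', h₁, h₂⟩ := hs.distSubst_comm hr
      exact ⟨r', h₁, .sV h₂⟩
    | subL _ h =>
      obtain ⟨r', h₁, h₂⟩ := ih h
      exact ⟨_, .sub s h₁, .subL s h₂⟩
    | subR _ h => exact ⟨_, .sub _ hr, .subR _ h⟩

theorem diamond {R₁ R₂ : VRule} {t u₁ u₂ : LT} (h₁ : SurfStep R₁ t u₁) (h₂ : SurfStep R₂ t u₂) :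
    (R₁ = R₂ ∧ u₁ = u₂) ∨ ∃ s, SurfStep R₂ u₁ s ∧ SurfStep R₁ u₂ s := by
  induction h₁ generalizing u₂ with
  | dB h =>
    cases h₂ with
    | dB h' => exact .inl ⟨rfl, h.unique h'⟩
    | appL _ h' =>
      obtain ⟨r, hd, hs⟩ := h'.distBeta_left h
      exact .inr ⟨r, hs, .dB hd⟩
    | appR _ h' =>
      obtain ⟨r, hd, hs⟩ := h'.distBeta_right h
      exact .inr ⟨r, hs, .dB hd⟩
  | sV h =>
    cases h₂ with
    | sV h' => exact .inl ⟨rfl, h.unique h'⟩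
    | subL _ h' =>
      obtain ⟨r, hd, hs⟩ := h'.distSubst_left h
      exact .inr ⟨r, hs, .sV hd⟩
    | subR _ h' =>
      obtain ⟨r, hd, hs⟩ := h'.distSubst_right h
      exact .inr ⟨r, hs, .sV hd⟩
  | appL u h ih =>
    cases h₂ with
    | dB h' =>
      obtain ⟨r, hd, hs⟩ := h.distBeta_left h'
      exact .inr ⟨r, .dB hd, hs⟩
    | appL _ h' =>
      rcases ih h' with ⟨rfl, rfl⟩ | ⟨s, hs₁, hs₂⟩
      · exact .inl ⟨rfl, rfl⟩
      · exact .inr ⟨_, .appL u hs₁, .appL u hs₂⟩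
    | appR _ h' => exact .inr ⟨_, .appR _ h', .appL _ h⟩
  | appR u h ih =>
    cases h₂ with
    | dB h' =>
      obtain ⟨r, hd, hs⟩ := h.distBeta_right h'
      exact .inr ⟨r, .dB hd, hs⟩
    | appL _ h' => exact .inr ⟨_, .appL _ h', .appR _ h⟩
    | appR _ h' =>
      rcases ih h' with ⟨rfl, rfl⟩ | ⟨s, hs₁, hs₂⟩
      · exact .inl ⟨rfl, rfl⟩
      · exact .inr ⟨_, .appR u hs₁, .appR u hs₂⟩
  | subL u h ih =>
    cases h₂ with
    | sV h' =>
      obtain ⟨r, hd, hs⟩ := h.distSubst_left h'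
      exact .inr ⟨r, .sV hd, hs⟩
    | subL _ h' =>
      rcases ih h' with ⟨rfl, rfl⟩ | ⟨s, hs₁, hs₂⟩
      · exact .inl ⟨rfl, rfl⟩
      · exact .inr ⟨_, .subL u hs₁, .subL u hs₂⟩
    | subR _ h' => exact .inr ⟨_, .subR _ h', .subL _ h⟩
  | subR u h ih =>
    cases h₂ with
    | sV h' =>
      obtain ⟨r, hd, hs⟩ := h.distSubst_right h'
      exact .inr ⟨r, .sV hd, hs⟩
    | subL _ h' => exact .inr ⟨_, .subL _ h', .subR _ h⟩
    | subR _ h' =>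
      rcases ih h' with ⟨rfl, rfl⟩ | ⟨s, hs₁, hs₂⟩
      · exact .inl ⟨rfl, rfl⟩
      · exact .inr ⟨_, .subR u hs₁, .subR u hs₂⟩

end SurfStep

theorem vSStepR_diamond {R₁ R₂ : VRule} {t u₁ u₂ : LT} (h₁ : VSStepR R₁ t u₁)
    (h₂ : VSStepR R₂ t u₂) :
    (R₁ = R₂ ∧ u₁ = u₂) ∨ ∃ s, VSStepR R₂ u₁ s ∧ VSStepR R₁ u₂ s := by
  simp only [vSStepR_iff_surfStep] at *
  exact h₁.diamond h₂

theorem vSStep_confluent {t u₁ u₂ : LT} (h₁ : Relation.ReflTransGen VSStep t u₁)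
    (h₂ : Relation.ReflTransGen VSStep t u₂) :
    ∃ s, Relation.ReflTransGen VSStep u₁ s ∧ Relation.ReflTransGen VSStep u₂ s := by
  refine Relation.church_rosser ?_ h₁ h₂
  rintro a b c ⟨R₁, hb⟩ ⟨R₂, hc⟩
  rcases vSStepR_diamond hb hc with ⟨-, rfl⟩ | ⟨d, hd₁, hd₂⟩
  · exact ⟨b, .refl, .refl⟩
  · exact ⟨d, .single ⟨R₂, hd₁⟩, .single ⟨R₁, hd₂⟩⟩

/-- A sequence from `t` to a normal form can be replaced by one through any reduct `u` of `t`,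
with one step fewer of the rule leading to `u` and as many of the other. -/
theorem counted2_residual {m n : ℕ} {t v : LT}
    (h : Counted2 (VSStepR .dB) (VSStepR .sV) m n t v) (hv : IsNF VSStep v) :
    (∀ u, VSStepR .dB t u →
      ∃ m', m = m' + 1 ∧ Counted2 (VSStepR .dB) (VSStepR .sV) m' n u v) ∧
    (∀ u, VSStepR .sV t u →
      ∃ n', n = n' + 1 ∧ Counted2 (VSStepR .dB) (VSStepR .sV) m n' u v) := by
  induction h with
  | refl t => exact ⟨fun u hu => (hv u ⟨_, hu⟩).elim, fun u hu => (hv u ⟨_, hu⟩).elim⟩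
  | step₁ hs hc ih =>
    constructor <;> intro u hu
    · rcases vSStepR_diamond hs hu with ⟨-, rfl⟩ | ⟨s, hs₁, hs₂⟩
      · exact ⟨_, rfl, hc⟩
      · obtain ⟨m', rfl, h⟩ := (ih hv).1 s hs₁
        exact ⟨_, rfl, .step₁ hs₂ h⟩
    · rcases vSStepR_diamond hs hu with ⟨h, -⟩ | ⟨s, hs₁, hs₂⟩
      · cases h
      · obtain ⟨n', rfl, h⟩ := (ih hv).2 s hs₁
        exact ⟨_, rfl, .step₁ hs₂ h⟩
  | step₂ hs hc ih =>
    constructor <;> intro u hu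
    · rcases vSStepR_diamond hs hu with ⟨h, -⟩ | ⟨s, hs₁, hs₂⟩
      · cases h
      · obtain ⟨m', rfl, h⟩ := (ih hv).1 s hs₁
        exact ⟨_, rfl, .step₂ hs₂ h⟩
    · rcases vSStepR_diamond hs hu with ⟨-, rfl⟩ | ⟨s, hs₁, hs₂⟩
      · exact ⟨_, rfl, hc⟩
      · obtain ⟨n', rfl, h⟩ := (ih hv).2 s hs₁
        exact ⟨_, rfl, .step₂ hs₂ h⟩

theorem counted2_eq_of_isNF {m₁ n₁ m₂ n₂ : ℕ} {t u₁ u₂ : LT}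
    (h₁ : Counted2 (VSStepR .dB) (VSStepR .sV) m₁ n₁ t u₁) (hu₁ : IsNF VSStep u₁)
    (h₂ : Counted2 (VSStepR .dB) (VSStepR .sV) m₂ n₂ t u₂) (hu₂ : IsNF VSStep u₂) :
    m₁ = m₂ ∧ n₁ = n₂ := by
  induction h₁ generalizing m₂ n₂ with
  | refl t =>
    cases h₂ with
    | refl => exact ⟨rfl, rfl⟩
    | step₁ h _ => exact (hu₁ _ ⟨_, h⟩).elim
    | step₂ h _ => exact (hu₁ _ ⟨_, h⟩).elim
  | step₁ hs _ ih =>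
    obtain ⟨m', rfl, h⟩ := (counted2_residual h₂ hu₂).1 _ hs
    obtain ⟨rfl, rfl⟩ := ih hu₁ h
    exact ⟨rfl, rfl⟩
  | step₂ hs _ ih =>
    obtain ⟨n', rfl, h⟩ := (counted2_residual h₂ hu₂).2 _ hs
    obtain ⟨rfl, rfl⟩ := ih hu₁ h
    exact ⟨rfl, rfl⟩

/-! ### Full reduction -/

/-- Parallel reduction for the CBV calculus; root redexes may be created by the reduction
of the subterms. -/
inductive Par : LT → LT → Prop
  | var (n : ℕ) : Par (LT.var n) (LT.var n)
  | app {a a' u u' : LT} : Par a a' → Par u u' → Par (LT.app a u) (LT.app a' u')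
  | lam {a a' : LT} : Par a a' → Par (LT.lam a) (LT.lam a')
  | sub {a a' u u' : LT} : Par a a' → Par u u' → Par (LT.sub a u) (LT.sub a' u')
  | dB {a a' u u' r : LT} : Par a a' → Par u u' → DistBeta a' u' r → Par (LT.app a u) r
  | sV {a a' u u' r : LT} : Par a a' → Par u u' → DistSubst a' u' r → Par (LT.sub a u) r

namespace Par

protected theorem refl (t : LT) : Par t t := by
  induction t with
  | var n => exact .var n
  | app _ _ iha ihb => exact .app iha ihb
  | lam _ ih => exact .lam ih
  | sub _ _ iha ihb => exact .sub iha ihb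

theorem isValue {v w : LT} (h : Par v w) (hv : v.IsValue) : w.IsValue := by
  cases h <;> trivial

protected theorem lift {t u : LT} (h : Par t u) (k : ℕ) : Par (lift k t) (lift k u) := by
  induction h generalizing k with
  | var n => exact .refl _
  | app _ _ iha ihb => exact .app (iha k) (ihb k)
  | lam _ ih => exact .lam (ih (k + 1))
  | sub _ _ iha ihb => exact .sub (iha (k + 1)) (ihb k)
  | dB _ _ h iha ihb => exact .dB (iha k) (ihb k) (h.lift k)
  | sV _ _ h iha ihb => exact .sV (iha (k + 1)) (ihb k) (h.lift k)

protected theorem liftN {t u : LT} (h : Par t u) (k : ℕ) : Par (liftN k t) (liftN k u) := by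
  induction k with
  | zero => exact h
  | succ k ih => rw [liftN_succ, liftN_succ]; exact ih.lift 0

protected theorem subst {t u v w : LT} (h : Par t u) (hvw : Par v w) (hv : v.IsValue) (k : ℕ) :
    Par (subst t k v) (subst u k w) := by
  induction h generalizing k with
  | var n =>
    simp only [LT.subst]
    split_ifs
    · exact .var _
    · exact hvw.liftN k
    · exact .var _
  | app _ _ iha ihb => exact .app (iha k) (ihb k)
  | lam _ ih => exact .lam (ih (k + 1))
  | sub _ _ iha ihb => exact .sub (iha (k + 1)) (ihb k)
  | dB _ _ h iha ihb => exact .dB (iha k) (ihb k) (h.subst k w)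
  | sV _ _ h iha ihb => exact .sV (iha (k + 1)) (ihb k) (h.subst (hvw.isValue hv) k)

theorem distBeta {a b u w r : LT} (h : Par a b) (hu : Par u w) (hr : DistBeta a u r) :
    ∃ r', DistBeta b w r' ∧ Par r r' := by
  induction hr generalizing b w with
  | lam t u => cases h with | lam h => exact ⟨_, .lam _ w, .sub h hu⟩
  | sub s hr ih =>
    cases h with
    | sub ha hs =>
      obtain ⟨r', h₁, h₂⟩ := ih ha (hu.lift 0)
      exact ⟨_, .sub _ h₁, .sub h₂ hs⟩
    | sV ha hs hd =>
      obtain ⟨r', h₁, h₂⟩ := ih ha (hu.lift 0)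
      obtain ⟨q, hq₁, hq₂⟩ := hd.distBeta_comm h₁
      exact ⟨q, hq₁, .sV h₂ hs hq₂⟩

theorem distSubst {t t' s s' r : LT} (h : Par t t') (hs : Par s s') (hr : DistSubst t s r) :
    ∃ r', DistSubst t' s' r' ∧ Par r r' := by
  induction hr generalizing t' s' with
  | val t hv => exact ⟨_, .val t' (hs.isValue hv), h.subst hs hv 0⟩
  | sub s hr ih =>
    cases hs with
    | sub ha hs =>
      obtain ⟨r', h₁, h₂⟩ := ih (h.lift 1) ha
      exact ⟨_, .sub _ h₁, .sub h₂ hs⟩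
    | sV ha hs hd =>
      obtain ⟨r', h₁, h₂⟩ := ih (h.lift 1) ha
      obtain ⟨q, hq₁, hq₂⟩ := hd.distSubst_comm h₁
      exact ⟨q, hq₁, .sV h₂ hs hq₂⟩

theorem diamond {t u₁ u₂ : LT} (h₁ : Par t u₁) (h₂ : Par t u₂) :
    ∃ s, Par u₁ s ∧ Par u₂ s := by
  induction h₁ generalizing u₂ with
  | var n => exact ⟨u₂, h₂, .refl _⟩
  | lam _ ih =>
    cases h₂ with
    | lam h =>
      obtain ⟨s, hs₁, hs₂⟩ := ih h
      exact ⟨_, .lam hs₁, .lam hs₂⟩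
  | app _ _ iha ihb =>
    cases h₂ with
    | app ha hb =>
      obtain ⟨p, hp₁, hp₂⟩ := iha ha
      obtain ⟨q, hq₁, hq₂⟩ := ihb hb
      exact ⟨_, .app hp₁ hq₁, .app hp₂ hq₂⟩
    | dB ha hb hd =>
      obtain ⟨p, hp₁, hp₂⟩ := iha ha
      obtain ⟨q, hq₁, hq₂⟩ := ihb hb
      obtain ⟨r, hr₁, hr₂⟩ := hp₂.distBeta hq₂ hd
      exact ⟨r, .dB hp₁ hq₁ hr₁, hr₂⟩
  | dB _ _ hd₁ iha ihb =>
    cases h₂ with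
    | app ha hb =>
      obtain ⟨p, hp₁, hp₂⟩ := iha ha
      obtain ⟨q, hq₁, hq₂⟩ := ihb hb
      obtain ⟨r, hr₁, hr₂⟩ := hp₁.distBeta hq₁ hd₁
      exact ⟨r, hr₂, .dB hp₂ hq₂ hr₁⟩
    | dB ha hb hd₂ =>
      obtain ⟨p, hp₁, hp₂⟩ := iha ha
      obtain ⟨q, hq₁, hq₂⟩ := ihb hb
      obtain ⟨r, hr₁, hr₂⟩ := hp₁.distBeta hq₁ hd₁
      obtain ⟨r', hr₁', hr₂'⟩ := hp₂.distBeta hq₂ hd₂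
      obtain rfl := hr₁.unique hr₁'
      exact ⟨r, hr₂, hr₂'⟩
  | sub _ _ iha ihb =>
    cases h₂ with
    | sub ha hb =>
      obtain ⟨p, hp₁, hp₂⟩ := iha ha
      obtain ⟨q, hq₁, hq₂⟩ := ihb hb
      exact ⟨_, .sub hp₁ hq₁, .sub hp₂ hq₂⟩
    | sV ha hb hd =>
      obtain ⟨p, hp₁, hp₂⟩ := iha ha
      obtain ⟨q, hq₁, hq₂⟩ := ihb hb
      obtain ⟨r, hr₁, hr₂⟩ := hp₂.distSubst hq₂ hd
      exact ⟨r, .sV hp₁ hq₁ hr₁, hr₂⟩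
  | sV _ _ hd₁ iha ihb =>
    cases h₂ with
    | sub ha hb =>
      obtain ⟨p, hp₁, hp₂⟩ := iha ha
      obtain ⟨q, hq₁, hq₂⟩ := ihb hb
      obtain ⟨r, hr₁, hr₂⟩ := hp₁.distSubst hq₁ hd₁
      exact ⟨r, hr₂, .sV hp₂ hq₂ hr₁⟩
    | sV ha hb hd₂ =>
      obtain ⟨p, hp₁, hp₂⟩ := iha ha
      obtain ⟨q, hq₁, hq₂⟩ := ihb hb
      obtain ⟨r, hr₁, hr₂⟩ := hp₁.distSubst hq₁ hd₁
      obtain ⟨r', hr₁', hr₂'⟩ := hp₂.distSubst hq₂ hd₂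
      obtain rfl := hr₁.unique hr₁'
      exact ⟨r, hr₂, hr₂'⟩

end Par

theorem VRoot.par {R : VRule} {a b : LT} (h : VRoot R a b) : Par a b := by
  cases h with
  | dB t u L => exact .dB (.refl _) (.refl _) (distBeta_fillLN t u L)
  | sV t v L hv => exact .sV (.refl _) (.refl _) (distSubst_fillLN t L hv)

theorem VFStep.par {t u : LT} (h : VFStep t u) : Par t u := by
  obtain ⟨R, C, a, b, h, rfl, rfl⟩ := h
  induction C with
  | hole => exact h.par
  | appL C s ih => exact .app ih (.refl s)
  | appR s C ih => exact .app (.refl s) ih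
  | lam C ih => exact .lam ih
  | subL C s ih => exact .sub ih (.refl s)
  | subR s C ih => exact .sub (.refl s) ih

theorem VRoot.vFStep {R : VRule} {a b : LT} (h : VRoot R a b) : VFStep a b :=
  ⟨R, .hole, a, b, h, rfl, rfl⟩

open Relation (ReflTransGen)

theorem vFStep_app {a a' u u' : LT} (ha : ReflTransGen VFStep a a')
    (hu : ReflTransGen VFStep u u') : ReflTransGen VFStep (LT.app a u) (LT.app a' u') := by
  refine .trans (ha.lift (LT.app · u) ?_) (hu.lift (LT.app a') ?_)
  · rintro _ _ ⟨R, C, x, y, h, rfl, rfl⟩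
    exact ⟨R, .appL C u, x, y, h, rfl, rfl⟩
  · rintro _ _ ⟨R, C, x, y, h, rfl, rfl⟩
    exact ⟨R, .appR a' C, x, y, h, rfl, rfl⟩

theorem vFStep_sub {a a' u u' : LT} (ha : ReflTransGen VFStep a a')
    (hu : ReflTransGen VFStep u u') : ReflTransGen VFStep (LT.sub a u) (LT.sub a' u') := by
  refine .trans (ha.lift (LT.sub · u) ?_) (hu.lift (LT.sub a') ?_)
  · rintro _ _ ⟨R, C, x, y, h, rfl, rfl⟩
    exact ⟨R, .subL C u, x, y, h, rfl, rfl⟩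
  · rintro _ _ ⟨R, C, x, y, h, rfl, rfl⟩
    exact ⟨R, .subR a' C, x, y, h, rfl, rfl⟩

theorem vFStep_lam {a a' : LT} (ha : ReflTransGen VFStep a a') :
    ReflTransGen VFStep (LT.lam a) (LT.lam a') := by
  refine ha.lift LT.lam ?_
  rintro _ _ ⟨R, C, x, y, h, rfl, rfl⟩
  exact ⟨R, .lam C, x, y, h, rfl, rfl⟩

theorem Par.reflTransGen_vFStep {t u : LT} (h : Par t u) : ReflTransGen VFStep t u := by
  induction h with
  | var n => exact .refl
  | app _ _ iha ihb => exact vFStep_app iha ihb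
  | lam _ ih => exact vFStep_lam ih
  | sub _ _ iha ihb => exact vFStep_sub iha ihb
  | dB _ _ h iha ihb => exact (vFStep_app iha ihb).tail h.vRoot.vFStep
  | sV _ _ h iha ihb => exact (vFStep_sub iha ihb).tail h.vRoot.vFStep

theorem reflTransGen_par_eq : ReflTransGen Par = ReflTransGen VFStep := by
  ext t u
  constructor
  · intro h
    induction h with
    | refl => exact .refl
    | tail _ h ih => exact ih.trans h.reflTransGen_vFStep
  · exact ReflTransGen.mono (fun _ _ => VFStep.par) t u

theorem vFStep_confluent {t u₁ u₂ : LT} (h₁ : ReflTransGen VFStep t u₁)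
    (h₂ : ReflTransGen VFStep t u₂) :
    ∃ s, ReflTransGen VFStep u₁ s ∧ ReflTransGen VFStep u₂ s := by
  rw [← reflTransGen_par_eq] at *
  refine Relation.church_rosser ?_ h₁ h₂
  intro a b c hb hc
  obtain ⟨d, hd₁, hd₂⟩ := hb.diamond hc
  exact ⟨d, .single hd₁, .single hd₂⟩

/-- **CBV confluence.**  (Surface) `→ᵛS` is confluent; moreover any two surface
reduction sequences from a common CBV term to `→ᵛS`-normal forms have the same length
and the same number of `dB`- and `sV`-steps.  (Full) `→ᵛF` is confluent. -/
theorem cbv_confluence :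
    ((∀ t u₁ u₂ : LT, Relation.ReflTransGen VSStep t u₁ →
        Relation.ReflTransGen VSStep t u₂ →
        ∃ s, Relation.ReflTransGen VSStep u₁ s ∧ Relation.ReflTransGen VSStep u₂ s) ∧
      (∀ (t u₁ u₂ : LT) (m₁ n₁ m₂ n₂ : ℕ),
        Counted2 (VSStepR VRule.dB) (VSStepR VRule.sV) m₁ n₁ t u₁ → IsNF VSStep u₁ →
        Counted2 (VSStepR VRule.dB) (VSStepR VRule.sV) m₂ n₂ t u₂ → IsNF VSStep u₂ →
        m₁ + n₁ = m₂ + n₂ ∧ m₁ = m₂ ∧ n₁ = n₂)) ∧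
    (∀ t u₁ u₂ : LT, Relation.ReflTransGen VFStep t u₁ →
      Relation.ReflTransGen VFStep t u₂ →
      ∃ s, Relation.ReflTransGen VFStep u₁ s ∧ Relation.ReflTransGen VFStep u₂ s) := by
  refine ⟨⟨fun t u₁ u₂ => vSStep_confluent, fun t u₁ u₂ m₁ n₁ m₂ n₂ h₁ hu₁ h₂ hu₂ => ?_⟩,
    fun t u₁ u₂ => vFStep_confluent⟩
  obtain ⟨rfl, rfl⟩ := counted2_eq_of_isNF h₁ hu₁ h₂ hu₂
  exact ⟨rfl, rfl, rfl⟩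

end BangPaper
end

section
/- (The surface/internal family is an SFS for λ!.) The family of pairs ((→S,R, →I,R))_{R ∈ {dB, s!, d!}} is a square factorization system for (λ!-terms, →F). Explicitly: →F is the union over R of →S,R ∪ →I,R; each →S,R is terminating; for each R, →I,R followed by →S,R is contained in (→S,R)⁺ followed by (→I,R)*; and for R₁ ≠ R₂, →I,R₁ followed by →S,R₂ is contained in →S,R₂ followed by (→S,R₁ ∪ →I,R₁)*. -/
namespace BangPaper

/-! ### Commutation of lifting and substitution -/

namespace T

theorem liftN_succ (m : ℕ) (t : T) : liftN (m + 1) t = lift 0 (liftN m t) :=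
  Function.iterate_succ_apply' _ _ _

theorem liftUnder_succ (m : ℕ) (t : T) : liftUnder (m + 1) t = lift 1 (liftUnder m t) :=
  Function.iterate_succ_apply' _ _ _

theorem lift_lift (t : T) : ∀ i k : ℕ, i ≤ k → lift (k + 1) (lift i t) = lift i (lift k t) := by
  induction t with
  | var n => intro i k h; simp only [lift]; split_ifs <;> simp only [lift] <;> split_ifs <;> grind
  | app a b iha ihb => intro i k h; simp only [lift, iha i k h, ihb i k h]
  | lam a iha => intro i k h; simp only [lift, iha (i + 1) (k + 1) (by omega)]
  | bang a iha => intro i k h; simp only [lift, iha i k h]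
  | der a iha => intro i k h; simp only [lift, iha i k h]
  | sub a b iha ihb => intro i k h; simp only [lift, iha (i + 1) (k + 1) (by omega), ihb i k h]

theorem lift_liftN (t : T) (k m : ℕ) : lift (k + m) (liftN m t) = liftN m (lift k t) := by
  induction m with
  | zero => rfl
  | succ m ih => rw [liftN_succ, liftN_succ, ← ih, ← lift_lift _ _ _ (Nat.zero_le _)]; rfl

theorem lift_liftUnder (t : T) (k m : ℕ) :
    lift (k + m + 1) (liftUnder m t) = liftUnder m (lift (k + 1) t) := by
  induction m with
  | zero => rfl
  | succ m ih =>
    rw [liftUnder_succ, liftUnder_succ, ← ih, ← lift_lift _ 1 _ (by omega)]; rfl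

theorem lift_liftN_of_le (t : T) {i m : ℕ} (h : i ≤ m) : lift i (liftN m t) = liftN (m + 1) t := by
  induction m generalizing i with
  | zero => obtain rfl : i = 0 := by omega
            rfl
  | succ m ih =>
    cases i with
    | zero => rw [← liftN_succ]
    | succ i => rw [liftN_succ, lift_lift _ _ _ (Nat.zero_le _), ih (by omega), ← liftN_succ]

theorem lift_subst_of_le (t v : T) :
    ∀ i k : ℕ, i ≤ k → lift i (subst t k v) = subst (lift i t) (k + 1) v := by
  induction t with
  | var n =>
    intro i k h
    have hv := lift_liftN_of_le v h
    simp only [lift, subst]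
    split_ifs <;> simp only [lift, subst] <;> split_ifs <;> grind
  | app a b iha ihb => intro i k h; simp only [lift, subst, iha i k h, ihb i k h]
  | lam a iha => intro i k h; simp only [lift, subst, iha (i + 1) (k + 1) (by omega)]
  | bang a iha => intro i k h; simp only [lift, subst, iha i k h]
  | der a iha => intro i k h; simp only [lift, subst, iha i k h]
  | sub a b iha ihb =>
    intro i k h; simp only [lift, subst, iha (i + 1) (k + 1) (by omega), ihb i k h]

theorem subst_liftN (t v : T) (k m : ℕ) :
    subst (liftN m t) (k + m) v = liftN m (subst t k v) := by
  induction m with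
  | zero => rfl
  | succ m ih => rw [liftN_succ, liftN_succ, ← ih, lift_subst_of_le _ _ _ _ (Nat.zero_le _)]; rfl

theorem subst_liftUnder (t v : T) (k m : ℕ) :
    subst (liftUnder m t) (k + m + 1) v = liftUnder m (subst t (k + 1) v) := by
  induction m with
  | zero => rfl
  | succ m ih =>
    rw [liftUnder_succ, liftUnder_succ, ← ih, lift_subst_of_le _ _ _ _ (by omega)]; rfl

theorem lift_subst (t u : T) :
    ∀ i j : ℕ, lift (j + i) (subst t i u) = subst (lift (j + i + 1) t) i (lift j u) := by
  induction t with
  | var n =>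
    intro i j
    have hu := lift_liftN u j i
    simp only [lift, subst]
    split_ifs <;> simp only [lift, subst] <;> split_ifs <;> grind
  | app a b iha ihb => intro i j; simp only [lift, subst, iha, ihb]
  | lam a iha =>
    intro i j
    have h := iha (i + 1) j
    simp only [lift, subst, ← add_assoc] at h ⊢
    rw [h]
  | bang a iha => intro i j; simp only [lift, subst, iha]
  | der a iha => intro i j; simp only [lift, subst, iha]
  | sub a b iha ihb =>
    intro i j
    have h := iha (i + 1) j
    simp only [lift, subst, ihb, ← add_assoc] at h ⊢
    rw [h]

theorem subst_lift (t u : T) : ∀ i : ℕ, subst (lift i t) i u = t := by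
  induction t with
  | var n => intro i; simp only [lift]; split_ifs <;> simp only [subst] <;> split_ifs <;> grind
  | app a b iha ihb => intro i; simp only [lift, subst, iha, ihb]
  | lam a iha => intro i; simp only [lift, subst, iha]
  | bang a iha => intro i; simp only [lift, subst, iha]
  | der a iha => intro i; simp only [lift, subst, iha]
  | sub a b iha ihb => intro i; simp only [lift, subst, iha, ihb]

theorem subst_subst (t u v : T) :
    ∀ i k : ℕ, subst (subst t i u) (k + i) v =
      subst (subst t (k + i + 1) v) i (subst u k v) := by
  induction t with
  | var n =>
    intro i k
    have hu := subst_liftN u v k i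
    have hv : subst (liftN (k + i + 1) v) i (subst u k v) = liftN (k + i) v := by
      rw [← lift_liftN_of_le v (Nat.le_add_left i k), subst_lift]
    simp only [subst]
    split_ifs <;> (try simp only [subst]) <;> (try split_ifs) <;> grind
  | app a b iha ihb => intro i k; simp only [subst, iha, ihb]
  | lam a iha =>
    intro i k
    have h := iha (i + 1) k
    simp only [subst, ← add_assoc] at h ⊢
    rw [h]
  | bang a iha => intro i k; simp only [subst, iha]
  | der a iha => intro i k; simp only [subst, iha]
  | sub a b iha ihb =>
    intro i k
    have h := iha (i + 1) k
    simp only [subst, ihb, ← add_assoc] at h ⊢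
    rw [h]

end T

/-! ### Stability of reduction under lifting and substitution -/

theorem exists_lift_fillL (L : List T) (k : ℕ) :
    ∃ L' : List T, L'.length = L.length ∧
      ∀ s, T.lift k (fillL s L) = fillL (T.lift (k + L.length) s) L' := by
  induction L with
  | nil => exact ⟨[], rfl, fun _ => rfl⟩
  | cons v L ih =>
    obtain ⟨L', hlen, hL'⟩ := ih
    exact ⟨T.lift (k + L.length) v :: L', by simp [hlen], fun s => by
      simp only [fillL, hL', T.lift, List.length_cons, add_assoc]⟩

theorem exists_subst_fillL (L : List T) (k : ℕ) (w : T) :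
    ∃ L' : List T, L'.length = L.length ∧
      ∀ s, T.subst (fillL s L) k w = fillL (T.subst s (k + L.length) w) L' := by
  induction L with
  | nil => exact ⟨[], rfl, fun _ => rfl⟩
  | cons v L ih =>
    obtain ⟨L', hlen, hL'⟩ := ih
    exact ⟨T.subst v (k + L.length) w :: L', by simp [hlen], fun s => by
      simp only [fillL, hL', T.subst, List.length_cons, add_assoc]⟩

theorem Root.lift {R : Rule} {a b : T} (h : Root R a b) (k : ℕ) :
    Root R (T.lift k a) (T.lift k b) := by
  cases h with
  | dB t u L =>
    obtain ⟨L', hlen, hL'⟩ := exists_lift_fillL L k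
    simp only [T.lift, hL', T.lift_liftN]
    rw [← hlen]
    exact Root.dB _ _ _
  | sBang t u L =>
    obtain ⟨L', hlen, hL'⟩ := exists_lift_fillL L k
    have h := T.lift_subst (T.liftUnder L.length t) u 0 (k + L.length)
    simp only [add_zero] at h
    simp only [T.lift, hL', h, T.lift_liftUnder]
    rw [← hlen]
    exact Root.sBang _ _ _
  | dBang t L =>
    obtain ⟨L', -, hL'⟩ := exists_lift_fillL L k
    simp only [T.lift, hL']
    exact Root.dBang _ _

theorem Root.subst {R : Rule} {a b : T} (h : Root R a b) (k : ℕ) (w : T) :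
    Root R (T.subst a k w) (T.subst b k w) := by
  cases h with
  | dB t u L =>
    obtain ⟨L', hlen, hL'⟩ := exists_subst_fillL L k w
    simp only [T.subst, hL', T.subst_liftN]
    rw [← hlen]
    exact Root.dB _ _ _
  | sBang t u L =>
    obtain ⟨L', hlen, hL'⟩ := exists_subst_fillL L k w
    have h := T.subst_subst (T.liftUnder L.length t) u w 0 (k + L.length)
    simp only [add_zero] at h
    simp only [T.subst, hL', h, T.subst_liftUnder]
    rw [← hlen]
    exact Root.sBang _ _ _
  | dBang t L =>
    obtain ⟨L', -, hL'⟩ := exists_subst_fillL L k w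
    simp only [T.subst, hL']
    exact Root.dBang _ _

/-! ### Surface closure -/

/-- The closure of a relation under surface contexts. -/
inductive SurfaceClosure (P : T → T → Prop) : T → T → Prop
  | base {a b : T} : P a b → SurfaceClosure P a b
  | appL {a b : T} (c : T) : SurfaceClosure P a b → SurfaceClosure P (T.app a c) (T.app b c)
  | appR {a b : T} (c : T) : SurfaceClosure P a b → SurfaceClosure P (T.app c a) (T.app c b)
  | lam {a b : T} : SurfaceClosure P a b → SurfaceClosure P (T.lam a) (T.lam b)
  | der {a b : T} : SurfaceClosure P a b → SurfaceClosure P (T.der a) (T.der b)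
  | subL {a b : T} (c : T) : SurfaceClosure P a b → SurfaceClosure P (T.sub a c) (T.sub b c)
  | subR {a b : T} (c : T) : SurfaceClosure P a b → SurfaceClosure P (T.sub c a) (T.sub c b)

/-- A full step of rule `R` immediately under a `!`. -/
inductive BangStep (R : Rule) : T → T → Prop
  | mk {a b : T} : FStepR R a b → BangStep R (T.bang a) (T.bang b)

/-- Surface steps, generated by congruence rules. -/
abbrev SurStep (R : Rule) : T → T → Prop := SurfaceClosure (Root R)

/-- Internal steps, generated by congruence rules. -/
abbrev IntStep (R : Rule) : T → T → Prop := SurfaceClosure (BangStep R)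

theorem SurfaceClosure.exists_ctx {P : T → T → Prop} {a b : T} (h : SurfaceClosure P a b) :
    ∃ C : Ctx, C.Surface ∧ ∃ x y, P x y ∧ a = C.fill x ∧ b = C.fill y := by
  induction h with
  | base h => exact ⟨.hole, trivial, _, _, h, rfl, rfl⟩
  | appL c _ ih =>
    obtain ⟨C, hC, x, y, h, rfl, rfl⟩ := ih; exact ⟨.appL C c, hC, x, y, h, rfl, rfl⟩
  | appR c _ ih =>
    obtain ⟨C, hC, x, y, h, rfl, rfl⟩ := ih; exact ⟨.appR c C, hC, x, y, h, rfl, rfl⟩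
  | lam _ ih => obtain ⟨C, hC, x, y, h, rfl, rfl⟩ := ih; exact ⟨.lam C, hC, x, y, h, rfl, rfl⟩
  | der _ ih => obtain ⟨C, hC, x, y, h, rfl, rfl⟩ := ih; exact ⟨.der C, hC, x, y, h, rfl, rfl⟩
  | subL c _ ih =>
    obtain ⟨C, hC, x, y, h, rfl, rfl⟩ := ih; exact ⟨.subL C c, hC, x, y, h, rfl, rfl⟩
  | subR c _ ih =>
    obtain ⟨C, hC, x, y, h, rfl, rfl⟩ := ih; exact ⟨.subR c C, hC, x, y, h, rfl, rfl⟩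

theorem SurfaceClosure.of_ctx {P : T → T → Prop} {x y : T} (h : P x y) (C : Ctx)
    (hC : C.Surface) : SurfaceClosure P (C.fill x) (C.fill y) := by
  induction C with
  | hole => exact .base h
  | appL C c ih => exact .appL c (ih hC)
  | appR c C ih => exact .appR c (ih hC)
  | lam C ih => exact .lam (ih hC)
  | bang C _ => exact hC.elim
  | der C ih => exact .der (ih hC)
  | subL C c ih => exact .subL c (ih hC)
  | subR c C ih => exact .subR c (ih hC)

theorem int_of_ctx {R : Rule} {x y : T} (h : Root R x y) (C : Ctx) (hC : C.Internal) :
    IntStep R (C.fill x) (C.fill y) := by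
  induction C with
  | hole => exact (hC trivial).elim
  | appL C c ih => exact .appL c (ih hC)
  | appR c C ih => exact .appR c (ih hC)
  | lam C ih => exact .lam (ih hC)
  | bang C _ => exact .base (.mk ⟨C, x, y, h, rfl, rfl⟩)
  | der C ih => exact .der (ih hC)
  | subL C c ih => exact .subL c (ih hC)
  | subR c C ih => exact .subR c (ih hC)

theorem IntStep.exists_ctx {R : Rule} {a b : T} (h : IntStep R a b) :
    ∃ C : Ctx, C.Internal ∧ StepAt R C a b := by
  induction h with
  | base h =>
    obtain ⟨C, x, y, h, rfl, rfl⟩ := h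
    exact ⟨.bang C, fun h => h, x, y, h, rfl, rfl⟩
  | appL c _ ih =>
    obtain ⟨C, hC, x, y, h, rfl, rfl⟩ := ih; exact ⟨.appL C c, hC, x, y, h, rfl, rfl⟩
  | appR c _ ih =>
    obtain ⟨C, hC, x, y, h, rfl, rfl⟩ := ih; exact ⟨.appR c C, hC, x, y, h, rfl, rfl⟩
  | lam _ ih => obtain ⟨C, hC, x, y, h, rfl, rfl⟩ := ih; exact ⟨.lam C, hC, x, y, h, rfl, rfl⟩
  | der _ ih => obtain ⟨C, hC, x, y, h, rfl, rfl⟩ := ih; exact ⟨.der C, hC, x, y, h, rfl, rfl⟩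
  | subL c _ ih =>
    obtain ⟨C, hC, x, y, h, rfl, rfl⟩ := ih; exact ⟨.subL C c, hC, x, y, h, rfl, rfl⟩
  | subR c _ ih =>
    obtain ⟨C, hC, x, y, h, rfl, rfl⟩ := ih; exact ⟨.subR c C, hC, x, y, h, rfl, rfl⟩

theorem sStepR_eq (R : Rule) : SStepR R = SurStep R := by
  funext t u
  refine propext ⟨?_, fun h => h.exists_ctx⟩
  rintro ⟨C, hC, a, b, h, rfl, rfl⟩
  exact .of_ctx h C hC

theorem iStepR_eq (R : Rule) : IStepR R = IntStep R := by
  funext t u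
  refine propext ⟨?_, fun h => h.exists_ctx⟩
  rintro ⟨C, hC, a, b, h, rfl, rfl⟩
  exact int_of_ctx h C hC

theorem fStepR_iff {R : Rule} {t u : T} : FStepR R t u ↔ SurStep R t u ∨ IntStep R t u := by
  rw [← sStepR_eq, ← iStepR_eq]
  constructor
  · rintro ⟨C, h⟩
    by_cases hC : C.Surface
    · exact .inl ⟨C, hC, h⟩
    · exact .inr ⟨C, hC, h⟩
  · rintro (⟨C, -, h⟩ | ⟨C, -, h⟩) <;> exact ⟨C, h⟩

namespace SurfaceClosure

theorem fillL {P : T → T → Prop} {a b : T} (h : SurfaceClosure P a b) (L : List T) :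
    SurfaceClosure P (fillL a L) (fillL b L) := by
  induction L generalizing a b with
  | nil => exact h
  | cons v L ih => exact ih (.subL v h)

theorem lift {P : T → T → Prop} (hP : ∀ k a b, P a b → P (T.lift k a) (T.lift k b)) {a b : T}
    (h : SurfaceClosure P a b) (k : ℕ) : SurfaceClosure P (T.lift k a) (T.lift k b) := by
  induction h generalizing k with
  | base h => exact .base (hP k _ _ h)
  | appL c _ ih => exact .appL _ (ih k)
  | appR c _ ih => exact .appR _ (ih k)
  | lam _ ih => exact .lam (ih (k + 1))
  | der _ ih => exact .der (ih k)
  | subL c _ ih => exact .subL _ (ih (k + 1))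
  | subR c _ ih => exact .subR _ (ih k)

theorem subst {P : T → T → Prop} {w : T}
    (hP : ∀ k a b, P a b → P (T.subst a k w) (T.subst b k w)) {a b : T}
    (h : SurfaceClosure P a b) (k : ℕ) : SurfaceClosure P (T.subst a k w) (T.subst b k w) := by
  induction h generalizing k with
  | base h => exact .base (hP k _ _ h)
  | appL c _ ih => exact .appL _ (ih k)
  | appR c _ ih => exact .appR _ (ih k)
  | lam _ ih => exact .lam (ih (k + 1))
  | der _ ih => exact .der (ih k)
  | subL c _ ih => exact .subL _ (ih (k + 1))
  | subR c _ ih => exact .subR _ (ih k)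

end SurfaceClosure

/-! ### Full steps under constructors, lifting and substitution -/

namespace FStepR

variable {R : Rule} {a b : T}

theorem appL (c : T) (h : FStepR R a b) : FStepR R (T.app a c) (T.app b c) := by
  obtain ⟨C, x, y, h, rfl, rfl⟩ := h; exact ⟨.appL C c, x, y, h, rfl, rfl⟩

theorem appR (c : T) (h : FStepR R a b) : FStepR R (T.app c a) (T.app c b) := by
  obtain ⟨C, x, y, h, rfl, rfl⟩ := h; exact ⟨.appR c C, x, y, h, rfl, rfl⟩

theorem lam (h : FStepR R a b) : FStepR R (T.lam a) (T.lam b) := by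
  obtain ⟨C, x, y, h, rfl, rfl⟩ := h; exact ⟨.lam C, x, y, h, rfl, rfl⟩

theorem bang (h : FStepR R a b) : FStepR R (T.bang a) (T.bang b) := by
  obtain ⟨C, x, y, h, rfl, rfl⟩ := h; exact ⟨.bang C, x, y, h, rfl, rfl⟩

theorem der (h : FStepR R a b) : FStepR R (T.der a) (T.der b) := by
  obtain ⟨C, x, y, h, rfl, rfl⟩ := h; exact ⟨.der C, x, y, h, rfl, rfl⟩

theorem subL (c : T) (h : FStepR R a b) : FStepR R (T.sub a c) (T.sub b c) := by
  obtain ⟨C, x, y, h, rfl, rfl⟩ := h; exact ⟨.subL C c, x, y, h, rfl, rfl⟩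

theorem subR (c : T) (h : FStepR R a b) : FStepR R (T.sub c a) (T.sub c b) := by
  obtain ⟨C, x, y, h, rfl, rfl⟩ := h; exact ⟨.subR c C, x, y, h, rfl, rfl⟩

theorem lift (h : FStepR R a b) (k : ℕ) : FStepR R (T.lift k a) (T.lift k b) := by
  obtain ⟨C, x, y, h, rfl, rfl⟩ := h
  induction C generalizing k with
  | hole => exact ⟨.hole, _, _, h.lift k, rfl, rfl⟩
  | appL C c ih => exact (ih k).appL _
  | appR c C ih => exact (ih k).appR _
  | lam C ih => exact (ih (k + 1)).lam
  | bang C ih => exact (ih k).bang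
  | der C ih => exact (ih k).der
  | subL C c ih => exact (ih (k + 1)).subL _
  | subR c C ih => exact (ih k).subR _

theorem subst (h : FStepR R a b) (k : ℕ) (w : T) :
    FStepR R (T.subst a k w) (T.subst b k w) := by
  obtain ⟨C, x, y, h, rfl, rfl⟩ := h
  induction C generalizing k with
  | hole => exact ⟨.hole, _, _, h.subst k w, rfl, rfl⟩
  | appL C c ih => exact (ih k).appL _
  | appR c C ih => exact (ih k).appR _
  | lam C ih => exact (ih (k + 1)).lam
  | bang C ih => exact (ih k).bang
  | der C ih => exact (ih k).der
  | subL C c ih => exact (ih (k + 1)).subL _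
  | subR c C ih => exact (ih k).subR _

theorem liftN (h : FStepR R a b) (m : ℕ) : FStepR R (T.liftN m a) (T.liftN m b) := by
  induction m with
  | zero => exact h
  | succ m ih => rw [T.liftN_succ, T.liftN_succ]; exact ih.lift 0

end FStepR

namespace IntStep

variable {R : Rule} {a b : T}

theorem lift (h : IntStep R a b) (k : ℕ) : IntStep R (T.lift k a) (T.lift k b) :=
  SurfaceClosure.lift (by rintro k _ _ ⟨h⟩; exact .mk (h.lift k)) h k

theorem subst (h : IntStep R a b) (k : ℕ) (w : T) : IntStep R (T.subst a k w) (T.subst b k w) :=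
  SurfaceClosure.subst (by rintro k _ _ ⟨h⟩; exact .mk (h.subst k w)) h k

theorem liftN (h : IntStep R a b) (m : ℕ) : IntStep R (T.liftN m a) (T.liftN m b) := by
  induction m with
  | zero => exact h
  | succ m ih => rw [T.liftN_succ, T.liftN_succ]; exact ih.lift 0

theorem liftUnder (h : IntStep R a b) (m : ℕ) : IntStep R (T.liftUnder m a) (T.liftUnder m b) := by
  induction m with
  | zero => exact h
  | succ m ih => rw [T.liftUnder_succ, T.liftUnder_succ]; exact ih.lift 1

end IntStep

/-! ### Surface-then-internal reduction sequences -/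

/-- `a` reduces to `b` by surface steps followed by internal steps, all of rule `R`. -/
def Factors (R : Rule) (a b : T) : Prop :=
  ∃ w, Relation.ReflTransGen (SurStep R) a w ∧ Relation.ReflTransGen (IntStep R) w b

namespace Factors

variable {R : Rule} {a b : T}

theorem refl (R : Rule) (a : T) : Factors R a a := ⟨a, .refl, .refl⟩

theorem of_int (h : IntStep R a b) : Factors R a b := ⟨a, .refl, .single h⟩

theorem of_fStepR (h : FStepR R a b) : Factors R a b := by
  rcases fStepR_iff.1 h with h | h
  · exact ⟨b, .single h, .refl⟩
  · exact .of_int h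

theorem map (f : T → T)
    (hf : ∀ (P : T → T → Prop) a b, SurfaceClosure P a b → SurfaceClosure P (f a) (f b))
    (h : Factors R a b) : Factors R (f a) (f b) := by
  obtain ⟨w, h₁, h₂⟩ := h
  exact ⟨f w, h₁.lift f (hf _), h₂.lift f (hf _)⟩

theorem map₂ (f : T → T → T)
    (hl : ∀ (P : T → T → Prop) c a b, SurfaceClosure P a b → SurfaceClosure P (f a c) (f b c))
    (hr : ∀ (P : T → T → Prop) c a b, SurfaceClosure P a b → SurfaceClosure P (f c a) (f c b))
    {c d : T} (h : Factors R a b) (h' : Factors R c d) : Factors R (f a c) (f b d) := by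
  obtain ⟨w, h₁, h₂⟩ := h
  obtain ⟨w', h₁', h₂'⟩ := h'
  exact ⟨f w w', (h₁.lift (f · c) (hl _ c)).trans (h₁'.lift (f w ·) (hr _ w)),
    (h₂.lift (f · w') (hl _ w')).trans (h₂'.lift (f b ·) (hr _ b))⟩

theorem bang (h : Factors R a b) : Factors R (T.bang a) (T.bang b) := by
  obtain ⟨w, h₁, h₂⟩ := h
  exact ⟨_, .refl, (h₁.lift T.bang fun _ _ h => .base (.mk (fStepR_iff.2 (.inl h)))).trans
    (h₂.lift T.bang fun _ _ h => .base (.mk (fStepR_iff.2 (.inr h))))⟩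

theorem subst_right (h : FStepR R a b) (t : T) (k : ℕ) :
    Factors R (T.subst t k a) (T.subst t k b) := by
  induction t generalizing k with
  | var n =>
    simp only [T.subst]
    split_ifs
    · exact .refl _ _
    · exact .of_fStepR (h.liftN k)
    · exact .refl _ _
  | app t u iht ihu =>
    exact map₂ T.app (fun _ c _ _ => .appL c) (fun _ c _ _ => .appR c) (iht k) (ihu k)
  | lam t ih => exact map T.lam (fun _ _ _ => .lam) (ih (k + 1))
  | bang t ih => exact (ih k).bang
  | der t ih => exact map T.der (fun _ _ _ => .der) (ih k)
  | sub t u iht ihu =>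
    exact map₂ T.sub (fun _ c _ _ => .subL c) (fun _ c _ _ => .subR c) (iht (k + 1)) (ihu k)

end Factors

/-! ### Swapping an internal step with a surface step -/

theorem int_fillL_inv {R : Rule} (L : List T) {s t : T} (h : IntStep R t (fillL s L)) :
    (∃ s₀, t = fillL s₀ L ∧ IntStep R s₀ s) ∨
      ∃ L₀ : List T, L₀.length = L.length ∧ t = fillL s L₀ ∧
        ∀ s', IntStep R (fillL s' L₀) (fillL s' L) := by
  induction L generalizing s with
  | nil => exact .inl ⟨t, rfl, h⟩
  | cons v L ih =>
    rcases ih h with ⟨s₀, rfl, hs⟩ | ⟨L₀, hlen, rfl, hL⟩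
    · cases hs with
      | base h => cases h
      | subL _ h' => exact .inl ⟨_, rfl, h'⟩
      | subR _ h' =>
        exact .inr ⟨_ :: L, by simp, rfl, fun s' => (SurfaceClosure.subR s' h').fillL L⟩
    · exact .inr ⟨v :: L₀, by simp [hlen], rfl, fun s' => hL _⟩

theorem int_lam_inv {R : Rule} {t s : T} (h : IntStep R t (T.lam s)) :
    ∃ s₀, t = T.lam s₀ ∧ IntStep R s₀ s := by
  cases h with
  | base h => cases h
  | lam h => exact ⟨_, rfl, h⟩

theorem int_bang_inv {R : Rule} {t s : T} (h : IntStep R t (T.bang s)) :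
    ∃ s₀, t = T.bang s₀ ∧ FStepR R s₀ s := by
  cases h with
  | base h => cases h with
    | mk h => exact ⟨_, rfl, h⟩

theorem swap_root {R₁ R₂ : Rule} {t u v : T} (h₁ : IntStep R₁ t u) (h₂ : Root R₂ u v) :
    ∃ w, Root R₂ t w ∧ Factors R₁ w v := by
  cases h₂ with
  | dB s r L =>
    cases h₁ with
    | base h => cases h
    | appL _ h =>
      rcases int_fillL_inv L h with ⟨s₀, rfl, hs⟩ | ⟨L₀, hlen, rfl, hL⟩
      · obtain ⟨s₀, rfl, hs'⟩ := int_lam_inv hs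
        exact ⟨_, .dB s₀ r L, .of_int ((SurfaceClosure.subL _ hs').fillL L)⟩
      · refine ⟨_, .dB s r L₀, ?_⟩
        rw [hlen]
        exact .of_int (hL _)
    | appR _ h => exact ⟨_, .dB s _ L, .of_int ((SurfaceClosure.subR _ (IntStep.liftN h _)).fillL L)⟩
  | sBang s r L =>
    cases h₁ with
    | base h => cases h
    | subL _ h =>
      exact ⟨_, .sBang _ r L, .of_int (((IntStep.liftUnder h _).subst _ _).fillL L)⟩
    | subR _ h =>
      rcases int_fillL_inv L h with ⟨s₀, rfl, hs⟩ | ⟨L₀, hlen, rfl, hL⟩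
      · obtain ⟨r₀, rfl, hr⟩ := int_bang_inv hs
        exact ⟨_, .sBang s r₀ L,
          (Factors.subst_right hr _ _).map (fillL · L) fun _ _ _ h => h.fillL L⟩
      · refine ⟨_, .sBang s r L₀, ?_⟩
        rw [hlen]
        exact .of_int (hL _)
  | dBang s L =>
    cases h₁ with
    | base h => cases h
    | der h =>
      rcases int_fillL_inv L h with ⟨s₀, rfl, hs⟩ | ⟨L₀, hlen, rfl, hL⟩
      · obtain ⟨s₀, rfl, hs'⟩ := int_bang_inv hs
        exact ⟨_, .dBang s₀ L, (Factors.of_fStepR hs').map (fillL · L) fun _ _ _ h => h.fillL L⟩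
      · exact ⟨_, .dBang s L₀, .of_int (hL _)⟩

theorem swap {R₁ R₂ : Rule} {t u v : T} (h₁ : IntStep R₁ t u) (h₂ : SurStep R₂ u v) :
    ∃ w, SurStep R₂ t w ∧ Factors R₁ w v := by
  induction h₂ generalizing t with
  | base h₂ =>
    obtain ⟨w, h, hf⟩ := swap_root h₁ h₂
    exact ⟨w, .base h, hf⟩
  | appL c h₂ ih =>
    cases h₁ with
    | base h => cases h
    | appL _ h =>
      obtain ⟨w, hs, hf⟩ := ih h
      exact ⟨_, .appL c hs, hf.map (T.app · c) fun _ _ _ => .appL c⟩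
    | appR _ h => exact ⟨_, .appL _ h₂, .of_int (.appR _ h)⟩
  | appR c h₂ ih =>
    cases h₁ with
    | base h => cases h
    | appL _ h => exact ⟨_, .appR _ h₂, .of_int (.appL _ h)⟩
    | appR _ h =>
      obtain ⟨w, hs, hf⟩ := ih h
      exact ⟨_, .appR c hs, hf.map (T.app c ·) fun _ _ _ => .appR c⟩
  | lam h₂ ih =>
    cases h₁ with
    | base h => cases h
    | lam h =>
      obtain ⟨w, hs, hf⟩ := ih h
      exact ⟨_, .lam hs, hf.map T.lam fun _ _ _ => .lam⟩
  | der h₂ ih =>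
    cases h₁ with
    | base h => cases h
    | der h =>
      obtain ⟨w, hs, hf⟩ := ih h
      exact ⟨_, .der hs, hf.map T.der fun _ _ _ => .der⟩
  | subL c h₂ ih =>
    cases h₁ with
    | base h => cases h
    | subL _ h =>
      obtain ⟨w, hs, hf⟩ := ih h
      exact ⟨_, .subL c hs, hf.map (T.sub · c) fun _ _ _ => .subL c⟩
    | subR _ h => exact ⟨_, .subL _ h₂, .of_int (.subR _ h)⟩
  | subR c h₂ ih =>
    cases h₁ with
    | base h => cases h
    | subL _ h => exact ⟨_, .subR _ h₂, .of_int (.subL _ h)⟩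
    | subR _ h =>
      obtain ⟨w, hs, hf⟩ := ih h
      exact ⟨_, .subR c hs, hf.map (T.sub c ·) fun _ _ _ => .subR c⟩

/-! ### Termination of surface reduction, rule by rule -/

/-- The number of abstractions of a term. -/
def numLam : T → ℕ
  | .var _ => 0
  | .app a b => numLam a + numLam b
  | .lam a => numLam a + 1
  | .bang a => numLam a
  | .der a => numLam a
  | .sub a b => numLam a + numLam b

theorem numLam_lift (t : T) (k : ℕ) : numLam (T.lift k t) = numLam t := by
  induction t generalizing k with
  | var n => simp only [T.lift]; split_ifs <;> rfl
  | _ => simp_all [T.lift, numLam]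

theorem numLam_liftN (t : T) (m : ℕ) : numLam (T.liftN m t) = numLam t := by
  induction m with
  | zero => rfl
  | succ m ih => rw [T.liftN_succ, numLam_lift, ih]

theorem exists_numLam_fillL (L : List T) : ∃ c, ∀ s, numLam (fillL s L) = numLam s + c := by
  induction L with
  | nil => exact ⟨0, fun _ => rfl⟩
  | cons v L ih =>
    obtain ⟨c, hc⟩ := ih
    exact ⟨numLam v + c, fun s => by simp only [fillL, hc, numLam, add_assoc]⟩

theorem numLam_lt_of_sur {t u : T} (h : SurStep .dB t u) : numLam u < numLam t := by
  induction h with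
  | base h =>
    cases h with
    | dB t u L =>
      obtain ⟨c, hc⟩ := exists_numLam_fillL L
      simp only [numLam, hc, numLam_liftN]
      omega
  | _ => simp only [numLam]; omega

theorem exists_size_fillL (L : List T) : ∃ c, ∀ s, (fillL s L).size = s.size + c := by
  induction L with
  | nil => exact ⟨0, fun _ => rfl⟩
  | cons v L ih =>
    obtain ⟨c, hc⟩ := ih
    exact ⟨1 + v.size + c, fun s => by simp only [fillL, hc, T.size]; omega⟩

theorem size_lt_of_sur {t u : T} (h : SurStep .dBang t u) : u.size < t.size := by
  induction h with
  | base h =>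
    cases h with
    | dBang t L =>
      obtain ⟨c, hc⟩ := exists_size_fillL L
      simp only [T.size, hc]
      omega
  | _ => simp only [T.size]; omega

/-- Extension of a valuation of the de Bruijn variables by a value for variable `0`. -/
def consVal (x : ℕ) (ρ : ℕ → ℕ) : ℕ → ℕ
  | 0 => x
  | n + 1 => ρ n

/-- The weight of a term under a valuation `ρ` of its variables: an explicit substitution
assigns to its bound variable the weight of the substituted term. -/
def weight : T → (ℕ → ℕ) → ℕ
  | .var n, ρ => ρ n
  | .app a b, ρ => weight a ρ + weight b ρ
  | .lam a, ρ => weight a (consVal 0 ρ)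
  | .bang a, ρ => weight a ρ
  | .der a, ρ => weight a ρ
  | .sub a b, ρ => 1 + weight b ρ + weight a (consVal (weight b ρ) ρ)

theorem consVal_mono {x y : ℕ} {ρ σ : ℕ → ℕ} (h : x ≤ y) (hρ : ρ ≤ σ) :
    consVal x ρ ≤ consVal y σ := by
  rintro (_ | n)
  · exact h
  · exact hρ n

theorem weight_mono (t : T) : Monotone (weight t) := by
  induction t with
  | var n => exact fun ρ σ h => h n
  | app a b iha ihb => exact fun ρ σ h => add_le_add (iha h) (ihb h)
  | lam a ih => exact fun ρ σ h => ih (consVal_mono le_rfl h)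
  | bang a ih => exact ih
  | der a ih => exact ih
  | sub a b iha ihb =>
    exact fun ρ σ h => add_le_add (Nat.add_le_add_left (ihb h) 1) (iha (consVal_mono (ihb h) h))

theorem weight_lift (t : T) (k : ℕ) (ρ : ℕ → ℕ) :
    weight (T.lift k t) ρ = weight t fun n => if n < k then ρ n else ρ (n + 1) := by
  have hcons : ∀ x k (ρ : ℕ → ℕ),
      (fun n => if n < k + 1 then consVal x ρ n else consVal x ρ (n + 1)) =
        consVal x fun n => if n < k then ρ n else ρ (n + 1) := by
    intro x k ρ
    funext n
    cases n <;> simp [consVal]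
  induction t generalizing k ρ with
  | var n => simp only [T.lift]; split_ifs with h <;> simp [weight, h]
  | app a b iha ihb => simp only [T.lift, weight, iha, ihb]
  | lam a ih => simp only [T.lift, weight, ih, hcons]
  | bang a ih => simp only [T.lift, weight, ih]
  | der a ih => simp only [T.lift, weight, ih]
  | sub a b iha ihb => simp only [T.lift, weight, iha, ihb, hcons]

theorem weight_liftN (t : T) (m : ℕ) (ρ : ℕ → ℕ) :
    weight (T.liftN m t) ρ = weight t fun n => ρ (n + m) := by
  induction m generalizing ρ with
  | zero => rfl
  | succ m ih =>
    rw [T.liftN_succ, weight_lift, ih]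
    simp [add_assoc]

theorem weight_liftUnder (t : T) (m : ℕ) (ρ : ℕ → ℕ) :
    weight (T.liftUnder m t) ρ = weight t (consVal (ρ 0) fun n => ρ (n + 1 + m)) := by
  induction m generalizing ρ with
  | zero =>
    have : ρ = consVal (ρ 0) fun n => ρ (n + 1) := by funext n; cases n <;> rfl
    exact congrArg _ this
  | succ m ih =>
    rw [T.liftUnder_succ, weight_lift, ih]
    simp [add_assoc]

theorem weight_subst (t u : T) (k : ℕ) (ρ : ℕ → ℕ) :
    weight (T.subst t k u) ρ = weight t fun n =>
      if n < k then ρ n else if n = k then weight u (fun i => ρ (i + k)) else ρ (n - 1) := by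
  have hcons : ∀ x k (ρ : ℕ → ℕ),
      (fun n => if n < k + 1 then consVal x ρ n else if n = k + 1 then
        weight u (fun i => consVal x ρ (i + (k + 1))) else consVal x ρ (n - 1)) =
      consVal x fun n =>
        if n < k then ρ n else if n = k then weight u (fun i => ρ (i + k)) else ρ (n - 1) := by
    intro x k ρ
    funext n
    rcases n with _ | _ | n
    · simp [consVal]
    · rcases k with _ | k <;> simp [consVal]
    · simp [consVal]
  induction t generalizing k ρ with
  | var n => simp only [T.subst]; split_ifs <;> simp [weight, *, weight_liftN]
  | app a b iha ihb => simp only [T.subst, weight, iha, ihb]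
  | lam a ih => simp only [T.subst, weight, ih, hcons]
  | bang a ih => simp only [T.subst, weight, ih]
  | der a ih => simp only [T.subst, weight, ih]
  | sub a b iha ihb => simp only [T.subst, weight, iha, ihb, hcons]

theorem exists_weight_fillL (L : List T) (ρ : ℕ → ℕ) :
    ∃ c σ, (∀ n, σ (n + L.length) = ρ n) ∧ ∀ s, weight (fillL s L) ρ = c + weight s σ := by
  induction L with
  | nil => exact ⟨0, ρ, fun _ => rfl, fun s => (zero_add _).symm⟩
  | cons v L ih =>
    obtain ⟨c, σ, hσ, hc⟩ := ih
    exact ⟨c + (1 + weight v σ), consVal (weight v σ) σ, hσ, fun s => by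
      simp only [fillL, hc, weight, add_assoc]⟩

theorem weight_lt_of_sur {t u : T} (h : SurStep .sBang t u) (ρ : ℕ → ℕ) :
    weight u ρ < weight t ρ := by
  induction h generalizing ρ with
  | base h =>
    cases h with
    | sBang t u L =>
      obtain ⟨c, σ, hσ, hc⟩ := exists_weight_fillL L ρ
      have hle : weight (T.subst (T.liftUnder L.length t) 0 u) σ ≤
          weight t (consVal (c + weight u σ) ρ) := by
        rw [weight_subst, weight_liftUnder]
        refine weight_mono t ?_
        rintro (_ | n)
        · simp [consVal]
        · have h := hσ n
          simp only [consVal]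
          split_ifs
          all_goals first
            | omega
            | rw [show n + 1 + L.length - 1 = n + L.length by omega, h]
      simp only [weight, hc]
      omega
  | appL c _ ih => exact Nat.add_lt_add_right (ih ρ) _
  | appR c _ ih => exact Nat.add_lt_add_left (ih ρ) _
  | lam _ ih => exact ih _
  | der _ ih => exact ih ρ
  | subL c _ ih => exact Nat.add_lt_add_left (ih _) _
  | subR c _ ih =>
    have h := weight_mono c (consVal_mono (ih ρ).le (le_refl ρ))
    have := ih ρ
    simp only [weight]
    omega

theorem not_exists_seq_of_lt {r : T → T → Prop} (m : T → ℕ) (hm : ∀ a b, r a b → m b < m a) :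
    ¬ ∃ f : ℕ → T, ∀ n, r (f n) (f (n + 1)) := by
  rintro ⟨f, hf⟩
  obtain ⟨n, hn⟩ := WellFounded.not_rel_apply_succ (r := (· < ·)) (fun n => m (f n))
  exact hn (hm _ _ (hf n))

/-- **The surface/internal family is a square factorization system for λ!.**
`→F` is the union over the three rules `R` of `→S,R ∪ →I,R`; each `→S,R` is
terminating; row-swaps `→I,R ∘ →S,R ⊆ (→S,R)⁺ ∘ (→I,R)*` hold; and diagonal-swaps
`→I,R₁ ∘ →S,R₂ ⊆ →S,R₂ ∘ (→S,R₁ ∪ →I,R₁)*` hold for `R₁ ≠ R₂`. -/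
theorem bang_surface_internal_sfs :
    (∀ t u : T, FStep t u ↔ ∃ R, SStepR R t u ∨ IStepR R t u) ∧
    (∀ R : Rule, ¬ ∃ f : ℕ → T, ∀ n, SStepR R (f n) (f (n + 1))) ∧
    (∀ (R : Rule) (t u v : T), IStepR R t u → SStepR R u v →
      ∃ w, Relation.TransGen (SStepR R) t w ∧ Relation.ReflTransGen (IStepR R) w v) ∧
    (∀ R₁ R₂ : Rule, R₁ ≠ R₂ → ∀ t u v : T, IStepR R₁ t u → SStepR R₂ u v →
      ∃ w, SStepR R₂ t w ∧
        Relation.ReflTransGen (fun a b => SStepR R₁ a b ∨ IStepR R₁ a b) w v) := by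
  refine ⟨fun t u => exists_congr fun R => ?_, fun R => ?_, fun R t u v h₁ h₂ => ?_,
    fun R₁ R₂ _ t u v h₁ h₂ => ?_⟩
  · rw [fStepR_iff, sStepR_eq, iStepR_eq]
  · rw [sStepR_eq]
    cases R with
    | dB => exact not_exists_seq_of_lt numLam fun _ _ => numLam_lt_of_sur
    | sBang => exact not_exists_seq_of_lt (weight · 0) fun _ _ h => weight_lt_of_sur h 0
    | dBang => exact not_exists_seq_of_lt T.size fun _ _ => size_lt_of_sur
  · rw [iStepR_eq] at h₁ ⊢
    rw [sStepR_eq] at h₂ ⊢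
    obtain ⟨w, hs, w', hs', hi⟩ := swap h₁ h₂
    exact ⟨w', .head' hs hs', hi⟩
  · rw [iStepR_eq] at h₁ ⊢
    rw [sStepR_eq] at h₂ ⊢
    rw [sStepR_eq]
    obtain ⟨w, hs, w', hs', hi⟩ := swap h₁ h₂
    exact ⟨w, hs, (hs'.lift id fun _ _ => .inl).trans (hi.lift id fun _ _ => .inr)⟩

end BangPaper
end
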